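/- arXiv:2512.24915 — 10 statements merged into one kernel-verified Lean document; each statement's English description precedes it below -/
import Mathlib

section
/- Let L > 0 and M > 0 be real numbers. For all (t,s) ∈ [0,L] × [0,L] one has 0 ≤ (√M / sinh(√M·L)) · G_M(t,t) · G_M(s,s) ≤ G_M(t,s) ≤ G_M(t,t) ≤ tanh(√M·L/2)/(2·√M), and moreover G_M(L/2, L/2) = tanh(√M·L/2)/(2·√M). -/
open Real

/-- The Green function `G_M` of the operator `-y'' + M y` with Dirichlet
boundary conditions on `[0, L]`. -/
noncomputable def GreenM (M L t s : ℝ) : ℝ :=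
  if t ≤ s then
    Real.sinh (Real.sqrt M * t) * Real.sinh (Real.sqrt M * (L - s)) /
      (Real.sqrt M * Real.sinh (Real.sqrt M * L))
  else
    Real.sinh (Real.sqrt M * s) * Real.sinh (Real.sqrt M * (L - t)) /
      (Real.sqrt M * Real.sinh (Real.sqrt M * L))

theorem sinh_mul_sinh_sub_le_sinh_half_sq (x y : ℝ) :
    Real.sinh x * Real.sinh (y - x) ≤ Real.sinh (y / 2) ^ 2 := by
  obtain ⟨u, d, rfl, rfl⟩ : ∃ u d : ℝ, x = u + d ∧ y = 2 * u :=
    ⟨y / 2, x - y / 2, by ring, by ring⟩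
  have h : 2 * u - (u + d) = u - d := by ring
  rw [h, mul_div_cancel_left₀ u two_ne_zero, Real.sinh_add, Real.sinh_sub]
  nlinarith [Real.cosh_sq u, Real.cosh_sq d, sq_nonneg (Real.sinh d)]

theorem sinh_half_sq_div_eq_tanh {k y : ℝ} (hk : 0 < k) (hy : 0 < y) :
    Real.sinh (y / 2) ^ 2 / (k * Real.sinh y) = Real.tanh (y / 2) / (2 * k) := by
  have h : Real.sinh y = 2 * Real.sinh (y / 2) * Real.cosh (y / 2) := by
    rw [← Real.sinh_two_mul]
    congr 1
    ring
  have hs : 0 < Real.sinh (y / 2) := Real.sinh_pos_iff.2 (by positivity)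
  have hc := Real.cosh_pos (y / 2)
  rw [h, Real.tanh_eq_sinh_div_cosh]
  field_simp

theorem GreenM_self (M L t : ℝ) :
    GreenM M L t t = Real.sinh (Real.sqrt M * t) * Real.sinh (Real.sqrt M * (L - t)) /
      (Real.sqrt M * Real.sinh (Real.sqrt M * L)) := by
  simp [GreenM]

theorem GreenM_comm (M L t s : ℝ) : GreenM M L t s = GreenM M L s t := by
  rcases lt_trichotomy t s with h | rfl | h
  · simp [GreenM, h.le, h.not_ge]
  · rfl
  · simp [GreenM, h.le, h.not_ge]

/-- The product lower bound for the Green function, in terms of the values `a = sinh (k t)`,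
`b = sinh (k (L - t))`, `c = sinh (k s)`, `d = sinh (k (L - s))` and `S = sinh (k L)`. -/
theorem div_mul_div_mul_div_le_div {k S a b c d : ℝ} (hk : 0 < k) (hS : 0 < S) (ha : 0 ≤ a)
    (hb : 0 ≤ b) (hd : 0 ≤ d) (hbS : b ≤ S) (hcS : c ≤ S) :
    k / S * (a * b / (k * S)) * (c * d / (k * S)) ≤ a * d / (k * S) := by
  have h : k / S * (a * b / (k * S)) * (c * d / (k * S))
      = a * d / (k * S) * (b * c / (S * S)) := by
    field_simp
  rw [h]
  refine mul_le_of_le_one_right (by positivity) ((div_le_one (by positivity)).2 ?_)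
  exact (mul_le_mul_of_nonneg_left hcS hb).trans (mul_le_mul_of_nonneg_right hbS hS.le)

theorem mul_GreenM_self_mul_GreenM_self_le {M L t s : ℝ} (hL : 0 < L) (hM : 0 < M)
    (ht : 0 ≤ t) (hts : t ≤ s) (hs : s ≤ L) :
    Real.sqrt M / Real.sinh (Real.sqrt M * L) * GreenM M L t t * GreenM M L s s
      ≤ GreenM M L t s := by
  have hk : 0 < Real.sqrt M := Real.sqrt_pos.2 hM
  rw [GreenM_self, GreenM_self, GreenM, if_pos hts]
  exact div_mul_div_mul_div_le_div hk (Real.sinh_pos_iff.2 (by positivity))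
    (Real.sinh_nonneg_iff.2 (by positivity))
    (Real.sinh_nonneg_iff.2 (mul_nonneg hk.le (by linarith)))
    (Real.sinh_nonneg_iff.2 (mul_nonneg hk.le (by linarith)))
    (Real.sinh_le_sinh.2 (mul_le_mul_of_nonneg_left (by linarith) hk.le))
    (Real.sinh_le_sinh.2 (mul_le_mul_of_nonneg_left hs hk.le))

theorem stmt0 (L M : ℝ) (hL : 0 < L) (hM : 0 < M) :
    (∀ t ∈ Set.Icc (0:ℝ) L, ∀ s ∈ Set.Icc (0:ℝ) L,
      0 ≤ Real.sqrt M / Real.sinh (Real.sqrt M * L) * GreenM M L t t * GreenM M L s s ∧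
      Real.sqrt M / Real.sinh (Real.sqrt M * L) * GreenM M L t t * GreenM M L s s
        ≤ GreenM M L t s ∧
      GreenM M L t s ≤ GreenM M L t t ∧
      GreenM M L t t ≤ Real.tanh (Real.sqrt M * L / 2) / (2 * Real.sqrt M)) ∧
    GreenM M L (L / 2) (L / 2) = Real.tanh (Real.sqrt M * L / 2) / (2 * Real.sqrt M) := by
  have hk : 0 < Real.sqrt M := Real.sqrt_pos.2 hM
  have hS : 0 < Real.sinh (Real.sqrt M * L) := Real.sinh_pos_iff.2 (by positivity)
  have hnn : ∀ x, 0 ≤ x → 0 ≤ Real.sinh (Real.sqrt M * x) := fun x hx =>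
    Real.sinh_nonneg_iff.2 (by positivity)
  have hmono : ∀ x y, x ≤ y → Real.sinh (Real.sqrt M * x) ≤ Real.sinh (Real.sqrt M * y) :=
    fun x y hxy => Real.sinh_le_sinh.2 (mul_le_mul_of_nonneg_left hxy hk.le)
  have hself : ∀ x ∈ Set.Icc (0:ℝ) L, 0 ≤ GreenM M L x x := fun x hx => by
    rw [GreenM_self]
    exact div_nonneg (mul_nonneg (hnn _ hx.1) (hnn _ (sub_nonneg.2 hx.2))) (by positivity)
  have htanh := sinh_half_sq_div_eq_tanh hk (mul_pos hk hL)
  refine ⟨fun t ht s hs => ⟨?_, ?_, ?_, ?_⟩, ?_⟩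
  · exact mul_nonneg (mul_nonneg (by positivity) (hself t ht)) (hself s hs)
  · rcases le_total t s with h | h
    · exact mul_GreenM_self_mul_GreenM_self_le hL hM ht.1 h hs.2
    · rw [GreenM_comm M L t s, mul_right_comm]
      exact mul_GreenM_self_mul_GreenM_self_le hL hM hs.1 h ht.2
  · rw [GreenM_self, GreenM]
    split_ifs with h
    · exact div_le_div_of_nonneg_right
        (mul_le_mul_of_nonneg_left (hmono _ _ (by linarith)) (hnn _ ht.1)) (by positivity)
    · exact div_le_div_of_nonneg_right
        (mul_le_mul_of_nonneg_right (hmono _ _ (not_le.1 h).le) (hnn _ (sub_nonneg.2 ht.2)))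
        (by positivity)
  · rw [GreenM_self, ← htanh, mul_sub]
    exact div_le_div_of_nonneg_right (sinh_mul_sinh_sub_le_sinh_half_sq _ _) (by positivity)
  · rw [GreenM_self, ← htanh, sub_half, ← mul_div_assoc, sq]
end

section
/- Let L > 0 and M > 0 be real numbers. For all (x,s) ∈ [0,L] × [0,L] one has ∫₀ᴸ G_0(x,t) · G_M(t,s) dt = G(x,s), where G is given by the explicit piecewise formula below. -/
open Real

/-- The Green function `G_0` of the operator `-y''` with Dirichlet
boundary conditions on `[0, L]`. -/
noncomputable def GreenZero (L t s : ℝ) : ℝ :=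
  if t ≤ s then t * (L - s) / L else s * (L - t) / L

/-- The Green function `G` of the operator `y'''' - M y''` with Navier
boundary conditions on `[0, L]`, given by the explicit piecewise formula. -/
noncomputable def GreenK (M L x s : ℝ) : ℝ :=
  if x ≤ s then
    x * (L - s) / (M * L) -
      Real.sinh (Real.sqrt M * x) * Real.sinh (Real.sqrt M * (L - s)) /
        (M * Real.sqrt M * Real.sinh (Real.sqrt M * L))
  else
    s * (L - x) / (M * L) -
      Real.sinh (Real.sqrt M * s) * Real.sinh (Real.sqrt M * (L - x)) /
        (M * Real.sqrt M * Real.sinh (Real.sqrt M * L))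

theorem greenZero_of_le {L x t : ℝ} (h : x ≤ t) : GreenZero L x t = x * (L - t) / L :=
  if_pos h

theorem greenZero_of_ge {L x t : ℝ} (h : t ≤ x) : GreenZero L x t = t * (L - x) / L := by
  rcases h.eq_or_lt with rfl | h
  · exact if_pos le_rfl
  · exact if_neg h.not_ge

theorem integral_affine_mul_sinh {f : ℝ → ℝ} {a b c : ℝ} (p q d : ℝ) (hab : a ≤ b)
    (hc : c ≠ 0) (hf : ∀ t ∈ Set.Ioc a b, f t = (p + q * t) * sinh (c * t + d)) :
    IntervalIntegrable f MeasureTheory.volume a b ∧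
      ∫ t in a..b, f t =
        ((p + q * b) * cosh (c * b + d) / c - q * sinh (c * b + d) / c ^ 2) -
        ((p + q * a) * cosh (c * a + d) / c - q * sinh (c * a + d) / c ^ 2) := by
  have hint : IntervalIntegrable (fun t => (p + q * t) * sinh (c * t + d))
      MeasureTheory.volume a b :=
    Continuous.intervalIntegrable (by fun_prop) a b
  have heq : Set.EqOn (fun t => (p + q * t) * sinh (c * t + d)) f (Set.uIoc a b) := by
    rw [Set.uIoc_of_le hab]
    exact fun t ht => (hf t ht).symm
  refine ⟨hint.congr heq, ?_⟩
  rw [← intervalIntegral.integral_congr_ae (Filter.Eventually.of_forall heq)]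
  refine intervalIntegral.integral_eq_sub_of_hasDerivAt
    (f := fun t => (p + q * t) * cosh (c * t + d) / c - q * sinh (c * t + d) / c ^ 2)
    (fun t _ => ?_) hint
  have hin : HasDerivAt (fun t => c * t + d) c t := by
    simpa using ((hasDerivAt_id t).const_mul c).add_const d
  have haff : HasDerivAt (fun t => p + q * t) q t := by
    simpa using ((hasDerivAt_id t).const_mul q).const_add p
  refine (((haff.mul hin.cosh).div_const c).sub
    ((hin.sinh.const_mul q).div_const (c ^ 2))).congr_deriv ?_
  field_simp
  ring

theorem greenM_of_le {M L t s : ℝ} (h : t ≤ s) :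
    GreenM M L t s = sinh (√M * (L - s)) / (√M * sinh (√M * L)) * sinh (√M * t + 0) := by
  rw [GreenM, if_pos h, add_zero]
  ring

theorem greenM_of_lt {M L t s : ℝ} (h : s < t) :
    GreenM M L t s = sinh (√M * s) / (√M * sinh (√M * L)) * sinh (-√M * t + √M * L) := by
  rw [GreenM, if_neg h.not_ge, show √M * (L - t) = -√M * t + √M * L by ring]
  ring

theorem stmt1 (L M : ℝ) (hL : 0 < L) (hM : 0 < M) :
    ∀ x ∈ Set.Icc (0:ℝ) L, ∀ s ∈ Set.Icc (0:ℝ) L,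
      (∫ t in (0:ℝ)..L, GreenZero L x t * GreenM M L t s) = GreenK M L x s := by
  rintro x ⟨hx0, hxL⟩ s ⟨hs0, hsL⟩
  have hk : 0 < √M := Real.sqrt_pos.2 hM
  have hk2 : M = √M ^ 2 := (Real.sq_sqrt hM.le).symm
  have hS : sinh (√M * L) ≠ 0 := (Real.sinh_pos_iff.2 (mul_pos hk hL)).ne'
  have hadd : sinh (√M * L) =
      sinh (√M * s) * cosh (√M * (L - s)) + cosh (√M * s) * sinh (√M * (L - s)) := by
    rw [← Real.sinh_add]
    ring_nf
  set α := sinh (√M * (L - s)) / (√M * sinh (√M * L)) with hα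
  set β := sinh (√M * s) / (√M * sinh (√M * L)) with hβ
  rcases le_or_gt x s with h | h
  · obtain ⟨i₁, e₁⟩ := integral_affine_mul_sinh
      (f := fun t => GreenZero L x t * GreenM M L t s) 0 ((L - x) / L * α) 0 hx0 hk.ne'
      fun t ht => by
        simp only [greenZero_of_ge ht.2, greenM_of_le (ht.2.trans h), ← hα]; ring
    obtain ⟨i₂, e₂⟩ := integral_affine_mul_sinh
      (f := fun t => GreenZero L x t * GreenM M L t s) (x * α) (-(x / L) * α) 0 h hk.ne'
      fun t ht => by
        simp only [greenZero_of_le ht.1.le, greenM_of_le ht.2, ← hα]; field_simp; ring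
    obtain ⟨i₃, e₃⟩ := integral_affine_mul_sinh
      (f := fun t => GreenZero L x t * GreenM M L t s) (x * β) (-(x / L) * β) (√M * L) hsL
      (neg_ne_zero.2 hk.ne')
      fun t ht => by
        simp only [greenZero_of_le (h.trans ht.1.le), greenM_of_lt ht.1, ← hβ]; field_simp; ring
    rw [← intervalIntegral.integral_add_adjacent_intervals (i₁.trans i₂) i₃,
      ← intervalIntegral.integral_add_adjacent_intervals i₁ i₂, e₁, e₂, e₃, GreenK, if_pos h]
    rw [show -√M * s + √M * L = √M * (L - s) by ring, show -√M * L + √M * L = 0 by ring]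
    have hM3 : x * (L - s) / (M * L) = x * (L - s) / (√M ^ 2 * L) * ((sinh (√M * s) *
        cosh (√M * (L - s)) + cosh (√M * s) * sinh (√M * (L - s))) / sinh (√M * L)) := by
      rw [← hadd, div_self hS, mul_one, ← hk2]
    rw [hM3, show M * √M = √M ^ 2 * √M by rw [← hk2], hα, hβ]
    simp only [add_zero, mul_zero, sinh_zero, cosh_zero]
    generalize sinh (√M * L) = S at *
    field_simp
    ring
  · obtain ⟨i₁, e₁⟩ := integral_affine_mul_sinh
      (f := fun t => GreenZero L x t * GreenM M L t s) 0 ((L - x) / L * α) 0 hs0 hk.ne'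
      fun t ht => by
        simp only [greenZero_of_ge (ht.2.trans h.le), greenM_of_le ht.2, ← hα]; ring
    obtain ⟨i₂, e₂⟩ := integral_affine_mul_sinh
      (f := fun t => GreenZero L x t * GreenM M L t s) 0 ((L - x) / L * β) (√M * L) h.le
      (neg_ne_zero.2 hk.ne')
      fun t ht => by
        simp only [greenZero_of_ge ht.2, greenM_of_lt ht.1, ← hβ]; ring
    obtain ⟨i₃, e₃⟩ := integral_affine_mul_sinh
      (f := fun t => GreenZero L x t * GreenM M L t s) (x * β) (-(x / L) * β) (√M * L) hxL
      (neg_ne_zero.2 hk.ne')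
      fun t ht => by
        simp only [greenZero_of_le ht.1.le, greenM_of_lt (h.trans ht.1), ← hβ]; field_simp; ring
    rw [← intervalIntegral.integral_add_adjacent_intervals (i₁.trans i₂) i₃,
      ← intervalIntegral.integral_add_adjacent_intervals i₁ i₂, e₁, e₂, e₃, GreenK,
      if_neg h.not_ge]
    rw [show -√M * s + √M * L = √M * (L - s) by ring, show -√M * L + √M * L = 0 by ring,
      show -√M * x + √M * L = √M * (L - x) by ring]
    have hM3 : s * (L - x) / (M * L) = s * (L - x) / (√M ^ 2 * L) * ((sinh (√M * s) *
        cosh (√M * (L - s)) + cosh (√M * s) * sinh (√M * (L - s))) / sinh (√M * L)) := by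
      rw [← hadd, div_self hS, mul_one, ← hk2]
    rw [hM3, show M * √M = √M ^ 2 * √M by rw [← hk2], hα, hβ]
    simp only [add_zero, mul_zero, sinh_zero, cosh_zero]
    generalize sinh (√M * L) = S at *
    field_simp
    ring
end

section
/- Let L > 0 and M > 0 be real numbers. Then G(x,s) ≥ 0 for all (x,s) ∈ [0,L] × [0,L]. -/
open Real

theorem sinh_le_self_mul_cosh {t : ℝ} (ht : 0 ≤ t) : Real.sinh t ≤ t * Real.cosh t := by
  have hd : ∀ x : ℝ, HasDerivAt (fun y => y * Real.cosh y - Real.sinh y) (x * Real.sinh x) x := by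
    intro x
    exact (((hasDerivAt_id' x).mul (Real.hasDerivAt_cosh x)).sub
      (Real.hasDerivAt_sinh x)).congr_deriv (by ring)
  have hmono : MonotoneOn (fun y => y * Real.cosh y - Real.sinh y) (Set.Ici 0) := by
    refine monotoneOn_of_deriv_nonneg (convex_Ici 0)
      (fun x _ => (hd x).continuousAt.continuousWithinAt)
      (fun x _ => (hd x).differentiableAt.differentiableWithinAt) fun x hx => ?_
    rw [interior_Ici] at hx
    rw [(hd x).deriv]
    exact mul_nonneg (le_of_lt hx) (Real.sinh_nonneg_iff.2 (le_of_lt hx))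
  have h := hmono (Set.mem_Ici.2 le_rfl) (Set.mem_Ici.2 ht) ht
  simp only [zero_mul, Real.sinh_zero, sub_zero] at h
  linarith

theorem mul_sinh_le_mul_sinh {u c : ℝ} (hu : 0 ≤ u) (huc : u ≤ c) :
    c * Real.sinh u ≤ u * Real.sinh c := by
  obtain ⟨d, rfl⟩ : ∃ d, c = u + d := ⟨c - u, by ring⟩
  have hd : 0 ≤ d := by linarith
  have hsu := Real.sinh_nonneg_iff.2 hu
  have h1 : u * Real.sinh u * 1 ≤ u * Real.sinh u * Real.cosh d :=
    mul_le_mul_of_nonneg_left (Real.one_le_cosh d) (mul_nonneg hu hsu)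
  have h2 : Real.sinh u * d ≤ u * Real.cosh u * Real.sinh d :=
    mul_le_mul (sinh_le_self_mul_cosh hu) (Real.self_le_sinh_iff.2 hd) hd
      (mul_nonneg hu (Real.cosh_pos u).le)
  rw [Real.sinh_add]
  linarith

theorem mul_sinh_mul_sinh_le {a b c : ℝ} (ha : 0 ≤ a) (hb : 0 ≤ b) (hc : 0 < c)
    (habc : a + b ≤ c) :
    c * (Real.sinh a * Real.sinh b) ≤ a * b * Real.sinh c := by
  rcases (add_nonneg ha hb).eq_or_lt with h0 | h0
  · obtain rfl : a = 0 := by linarith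
    simp
  have hsum : (a + b) * (Real.sinh a * Real.sinh b) ≤ a * b * Real.sinh (a + b) := by
    have h1 := mul_le_mul_of_nonneg_left (sinh_le_self_mul_cosh hb)
      (mul_nonneg ha (Real.sinh_nonneg_iff.2 ha))
    have h2 := mul_le_mul_of_nonneg_left (sinh_le_self_mul_cosh ha)
      (mul_nonneg hb (Real.sinh_nonneg_iff.2 hb))
    rw [Real.sinh_add]
    linarith
  have h1 := mul_le_mul_of_nonneg_left hsum hc.le
  have h2 := mul_le_mul_of_nonneg_left (mul_sinh_le_mul_sinh h0.le habc) (mul_nonneg ha hb)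
  refine le_of_mul_le_mul_left ?_ h0
  linarith

theorem sinh_mul_sinh_div_le {L M p q : ℝ} (hL : 0 < L) (hM : 0 < M) (hp : 0 ≤ p)
    (hq : 0 ≤ q) (hpq : p + q ≤ L) :
    Real.sinh (Real.sqrt M * p) * Real.sinh (Real.sqrt M * q) /
        (M * Real.sqrt M * Real.sinh (Real.sqrt M * L)) ≤ p * q / (M * L) := by
  have hk : 0 < Real.sqrt M := Real.sqrt_pos.2 hM
  have hs : 0 < Real.sinh (Real.sqrt M * L) := Real.sinh_pos_iff.2 (mul_pos hk hL)
  have h := mul_sinh_mul_sinh_le (mul_nonneg hk.le hp) (mul_nonneg hk.le hq) (mul_pos hk hL)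
    (by rw [← mul_add]; exact mul_le_mul_of_nonneg_left hpq hk.le)
  rw [div_le_div_iff₀ (by positivity) (by positivity)]
  refine le_of_mul_le_mul_left ?_ hk
  have := mul_le_mul_of_nonneg_left h hM.le
  linarith

theorem stmt2 (L M : ℝ) (hL : 0 < L) (hM : 0 < M) :
    ∀ x ∈ Set.Icc (0:ℝ) L, ∀ s ∈ Set.Icc (0:ℝ) L, 0 ≤ GreenK M L x s := by
  intro x hx s hs
  obtain ⟨hx0, hxL⟩ := hx
  obtain ⟨hs0, hsL⟩ := hs
  unfold GreenK
  split_ifs with h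
  · exact sub_nonneg.2 (sinh_mul_sinh_div_le hL hM hx0 (by linarith) (by linarith))
  · exact sub_nonneg.2 (sinh_mul_sinh_div_le hL hM hs0 (by linarith) (by linarith))
end

section
/- Let L > 0 and M > 0 be real numbers and let N be a real number with |N| ≤ 8M/L³. Then for every continuous function p : [0,L] → ℝ, the nonlocal boundary value problem y''''(x) − M·y''(x) + N·∫₀ᴸ y(t)dt = p(x) for x ∈ (0,L), with y(0) = y(L) = y''(0) = y''(L) = 0, has a unique solution y of class C⁴ on [0,L], and this solution is given explicitly by y(x) = ∫₀ᴸ G(x,s)p(s)ds − (N·∫₀ᴸ G(x,s)ds)/(1 + N·∫₀ᴸ∫₀ᴸ G(x,s)ds dx) · ∫₀ᴸ∫₀ᴸ G(x,s)p(s)ds dx for x ∈ [0,L]. -/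
open Real

/-- `y` is a (classical, C⁴ on `[0,L]`) solution of the nonlocal boundary value
problem `y'''' - M y'' + N ∫₀ᴸ y = p` on `(0, L)` with Navier boundary
conditions `y(0) = y(L) = y''(0) = y''(L) = 0`. -/
def IsSolutionBVP (L M N : ℝ) (p y : ℝ → ℝ) : Prop :=
  ContDiffOn ℝ 4 y (Set.Icc 0 L) ∧
  (∀ x ∈ Set.Ioo (0:ℝ) L,
    iteratedDerivWithin 4 y (Set.Icc 0 L) x
      - M * iteratedDerivWithin 2 y (Set.Icc 0 L) x
      + N * ∫ t in (0:ℝ)..L, y t = p x) ∧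
  y 0 = 0 ∧ y L = 0 ∧
  iteratedDerivWithin 2 y (Set.Icc 0 L) 0 = 0 ∧
  iteratedDerivWithin 2 y (Set.Icc 0 L) L = 0

open intervalIntegral

/-- The variation-of-parameters expression `d(x) ∫₀ˣ a p + c(x) ∫ₓᴸ b p`. -/
noncomputable def variationOfParams (L : ℝ) (a b p c d : ℝ → ℝ) (x : ℝ) : ℝ :=
  d x * (∫ s in (0:ℝ)..x, a s * p s) + c x * ∫ s in x..L, b s * p s

lemma hasDerivAt_variationOfParams {L : ℝ} {a b p c d c' d' : ℝ → ℝ} (ha : Continuous a)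
    (hb : Continuous b) (hp : Continuous p) {x : ℝ} (hc : HasDerivAt c (c' x) x)
    (hd : HasDerivAt d (d' x) x) :
    HasDerivAt (variationOfParams L a b p c d)
      (variationOfParams L a b p c' d' x + (d x * a x - c x * b x) * p x) x := by
  have h1 : HasDerivAt (fun x => ∫ s in (0:ℝ)..x, a s * p s) (a x * p x) x :=
    integral_hasDerivAt_right ((ha.mul hp).intervalIntegrable _ _)
      ((ha.mul hp).stronglyMeasurableAtFilter _ _) (ha.mul hp).continuousAt
  have h2 : HasDerivAt (fun x => ∫ s in x..L, b s * p s) (-(b x * p x)) x :=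
    integral_hasDerivAt_left ((hb.mul hp).intervalIntegrable _ _)
      ((hb.mul hp).stronglyMeasurableAtFilter _ _) (hb.mul hp).continuousAt
  refine ((hd.mul h1).add (hc.mul h2)).congr_deriv ?_
  simp only [variationOfParams]
  ring

lemma variationOfParams_sub_const_mul {L : ℝ} {a b p q : ℝ → ℝ} (ha : Continuous a)
    (hb : Continuous b) (hp : Continuous p) (hq : Continuous q) (r : ℝ) (c d : ℝ → ℝ) (x : ℝ) :
    variationOfParams L a b (fun s => p s - r * q s) c d x =
      variationOfParams L a b p c d x - r * variationOfParams L a b q c d x := by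
  have h : ∀ f : ℝ → ℝ, Continuous f → ∀ u v : ℝ, ∫ s in u..v, f s * (p s - r * q s) =
      (∫ s in u..v, f s * p s) - r * ∫ s in u..v, f s * q s := by
    intro f hf u v
    rw [← integral_const_mul, ← integral_sub (Continuous.intervalIntegrable (by fun_prop) _ _)
      (Continuous.intervalIntegrable (by fun_prop) _ _)]
    congr 1
    ext s
    ring
  simp only [variationOfParams, h a ha, h b hb]
  ring

/-- The solution of `-w'' = p`, `w(0) = w(L) = 0`. -/
noncomputable def poissonSol (L : ℝ) (p : ℝ → ℝ) (x : ℝ) : ℝ :=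
  variationOfParams L (fun s => s) (fun s => L - s) p (fun s => s) (fun s => L - s) x / L

/-- The derivative of `poissonSol`. -/
noncomputable def poissonSolDeriv (L : ℝ) (p : ℝ → ℝ) (x : ℝ) : ℝ :=
  variationOfParams L (fun s => s) (fun s => L - s) p (fun _ => 1) (fun _ => -1) x / L

/-- The solution of `-w'' + k² w = p`, `w(0) = w(L) = 0`. -/
noncomputable def helmholtzSol (L k : ℝ) (p : ℝ → ℝ) (x : ℝ) : ℝ :=
  variationOfParams L (fun s => sinh (k * s)) (fun s => sinh (k * (L - s))) p
    (fun s => sinh (k * s)) (fun s => sinh (k * (L - s))) x / (k * sinh (k * L))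

/-- The derivative of `helmholtzSol`. -/
noncomputable def helmholtzSolDeriv (L k : ℝ) (p : ℝ → ℝ) (x : ℝ) : ℝ :=
  variationOfParams L (fun s => sinh (k * s)) (fun s => sinh (k * (L - s))) p
    (fun s => k * cosh (k * s)) (fun s => -(k * cosh (k * (L - s)))) x / (k * sinh (k * L))

/-- The solution of `u'''' - k² u'' = p` with Navier boundary conditions on `[0, L]`. -/
noncomputable def navierSol (L k : ℝ) (p : ℝ → ℝ) (x : ℝ) : ℝ :=
  (poissonSol L p x - helmholtzSol L k p x) / k ^ 2

section

variable {L k : ℝ} {p q : ℝ → ℝ}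

lemma hasDerivAt_poissonSol (hp : Continuous p) (x : ℝ) :
    HasDerivAt (poissonSol L p) (poissonSolDeriv L p x) x := by
  have h := hasDerivAt_variationOfParams (L := L) (a := fun s => s) (b := fun s => L - s)
    (c := fun s => s) (d := fun s => L - s) (c' := fun _ => 1) (d' := fun _ => -1)
    (by fun_prop) (by fun_prop) hp (hasDerivAt_id x) ((hasDerivAt_id x).const_sub L)
  refine (h.div_const L).congr_deriv ?_
  simp only [poissonSolDeriv]
  ring

lemma hasDerivAt_poissonSolDeriv (hL : 0 < L) (hp : Continuous p) (x : ℝ) :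
    HasDerivAt (poissonSolDeriv L p) (-p x) x := by
  have h := hasDerivAt_variationOfParams (L := L) (a := fun s => s) (b := fun s => L - s)
    (c := fun _ => 1) (d := fun _ => -1) (c' := fun _ => 0) (d' := fun _ => 0)
    (by fun_prop) (by fun_prop) hp (hasDerivAt_const x 1) (hasDerivAt_const x (-1))
  refine (h.div_const L).congr_deriv ?_
  simp only [variationOfParams]
  field_simp
  ring

lemma hasDerivAt_sinh_mul (k x : ℝ) :
    HasDerivAt (fun s => sinh (k * s)) (k * cosh (k * x)) x :=
  ((hasDerivAt_id x).const_mul k).sinh.congr_deriv (by simp; ring)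

lemma hasDerivAt_sinh_mul_sub (k L x : ℝ) :
    HasDerivAt (fun s => sinh (k * (L - s))) (-(k * cosh (k * (L - x)))) x :=
  (((hasDerivAt_id x).const_sub L).const_mul k).sinh.congr_deriv (by simp; ring)

lemma hasDerivAt_cosh_mul (k x : ℝ) :
    HasDerivAt (fun s => k * cosh (k * s)) (k ^ 2 * sinh (k * x)) x :=
  (((hasDerivAt_id x).const_mul k).cosh.const_mul k).congr_deriv (by simp; ring)

lemma hasDerivAt_cosh_mul_sub (k L x : ℝ) :
    HasDerivAt (fun s => -(k * cosh (k * (L - s)))) (k ^ 2 * sinh (k * (L - x))) x :=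
  ((((hasDerivAt_id x).const_sub L).const_mul k).cosh.const_mul k).neg.congr_deriv
    (by simp; ring)

lemma hasDerivAt_helmholtzSol (hp : Continuous p) (x : ℝ) :
    HasDerivAt (helmholtzSol L k p) (helmholtzSolDeriv L k p x) x := by
  have h := hasDerivAt_variationOfParams (L := L) (a := fun s => sinh (k * s))
    (b := fun s => sinh (k * (L - s))) (c' := fun s => k * cosh (k * s))
    (d' := fun s => -(k * cosh (k * (L - s)))) (by fun_prop) (by fun_prop) hp
    (hasDerivAt_sinh_mul k x) (hasDerivAt_sinh_mul_sub k L x)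
  refine (h.div_const (k * sinh (k * L))).congr_deriv ?_
  simp only [helmholtzSolDeriv]
  ring

lemma hasDerivAt_helmholtzSolDeriv (hL : 0 < L) (hk : 0 < k) (hp : Continuous p) (x : ℝ) :
    HasDerivAt (helmholtzSolDeriv L k p) (k ^ 2 * helmholtzSol L k p x - p x) x := by
  have h := hasDerivAt_variationOfParams (L := L) (a := fun s => sinh (k * s))
    (b := fun s => sinh (k * (L - s))) (c' := fun s => k ^ 2 * sinh (k * s))
    (d' := fun s => k ^ 2 * sinh (k * (L - s))) (by fun_prop) (by fun_prop) hp
    (hasDerivAt_cosh_mul k x) (hasDerivAt_cosh_mul_sub k L x)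
  refine (h.div_const (k * sinh (k * L))).congr_deriv ?_
  have hS : 0 < sinh (k * L) := sinh_pos_iff.2 (by positivity)
  have hadd : sinh (k * L) = sinh (k * x) * cosh (k * (L - x)) +
      cosh (k * x) * sinh (k * (L - x)) := by
    rw [← sinh_add]
    ring_nf
  simp only [helmholtzSol, variationOfParams]
  field_simp
  rw [hadd]
  ring

lemma poissonSol_left : poissonSol L p 0 = 0 := by simp [poissonSol, variationOfParams]

lemma poissonSol_right : poissonSol L p L = 0 := by simp [poissonSol, variationOfParams]

lemma helmholtzSol_left : helmholtzSol L k p 0 = 0 := by simp [helmholtzSol, variationOfParams]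

lemma helmholtzSol_right : helmholtzSol L k p L = 0 := by simp [helmholtzSol, variationOfParams]

lemma navierSol_left : navierSol L k p 0 = 0 := by
  simp [navierSol, poissonSol_left, helmholtzSol_left]

lemma navierSol_right : navierSol L k p L = 0 := by
  simp [navierSol, poissonSol_right, helmholtzSol_right]

lemma hasDerivAt_navierSol (hp : Continuous p) (x : ℝ) :
    HasDerivAt (navierSol L k p)
      ((poissonSolDeriv L p x - helmholtzSolDeriv L k p x) / k ^ 2) x :=
  ((hasDerivAt_poissonSol hp x).sub (hasDerivAt_helmholtzSol hp x)).div_const _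

lemma deriv_deriv_navierSol (hL : 0 < L) (hk : 0 < k) (hp : Continuous p) :
    deriv (deriv (navierSol L k p)) = fun x => -helmholtzSol L k p x := by
  rw [show deriv (navierSol L k p) =
    fun x => (poissonSolDeriv L p x - helmholtzSolDeriv L k p x) / k ^ 2 from
      funext fun x => (hasDerivAt_navierSol hp x).deriv]
  ext x
  refine ((((hasDerivAt_poissonSolDeriv hL hp x).sub
    (hasDerivAt_helmholtzSolDeriv hL hk hp x)).div_const (k ^ 2)).congr_deriv ?_).deriv
  field_simp
  ring

lemma differentiable_deriv_navierSol (hL : 0 < L) (hk : 0 < k) (hp : Continuous p) :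
    Differentiable ℝ (deriv (navierSol L k p)) := by
  rw [show deriv (navierSol L k p) =
    fun x => (poissonSolDeriv L p x - helmholtzSolDeriv L k p x) / k ^ 2 from
      funext fun x => (hasDerivAt_navierSol hp x).deriv]
  exact fun x => (((hasDerivAt_poissonSolDeriv hL hp x).sub
    (hasDerivAt_helmholtzSolDeriv hL hk hp x)).div_const (k ^ 2)).differentiableAt

lemma deriv_helmholtzSol (hp : Continuous p) :
    deriv (helmholtzSol L k p) = helmholtzSolDeriv L k p :=
  funext fun x => (hasDerivAt_helmholtzSol hp x).deriv

lemma deriv_helmholtzSolDeriv (hL : 0 < L) (hk : 0 < k) (hp : Continuous p) :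
    deriv (helmholtzSolDeriv L k p) = fun x => k ^ 2 * helmholtzSol L k p x - p x :=
  funext fun x => (hasDerivAt_helmholtzSolDeriv hL hk hp x).deriv

lemma differentiable_helmholtzSol (hp : Continuous p) :
    Differentiable ℝ (helmholtzSol L k p) :=
  fun x => (hasDerivAt_helmholtzSol hp x).differentiableAt

lemma differentiable_navierSol (hp : Continuous p) :
    Differentiable ℝ (navierSol L k p) :=
  fun x => (hasDerivAt_navierSol hp x).differentiableAt

lemma contDiff_two_helmholtzSol (hL : 0 < L) (hk : 0 < k) (hp : Continuous p) :
    ContDiff ℝ 2 (helmholtzSol L k p) := by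
  rw [show (2 : WithTop ℕ∞) = 1 + 1 from by norm_num, contDiff_succ_iff_deriv]
  refine ⟨differentiable_helmholtzSol hp, by simp, ?_⟩
  rw [deriv_helmholtzSol hp, contDiff_one_iff_deriv]
  refine ⟨fun x => (hasDerivAt_helmholtzSolDeriv hL hk hp x).differentiableAt, ?_⟩
  rw [deriv_helmholtzSolDeriv hL hk hp]
  exact (continuous_const.mul (differentiable_helmholtzSol hp).continuous).sub hp

lemma contDiff_navierSol (hL : 0 < L) (hk : 0 < k) (hp : Continuous p) :
    ContDiff ℝ 4 (navierSol L k p) := by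
  rw [show (4 : WithTop ℕ∞) = 2 + 1 + 1 from by norm_num, contDiff_succ_iff_deriv]
  refine ⟨differentiable_navierSol hp, by simp, ?_⟩
  rw [contDiff_succ_iff_deriv]
  refine ⟨differentiable_deriv_navierSol hL hk hp, by simp, ?_⟩
  rw [deriv_deriv_navierSol hL hk hp]
  exact (contDiff_two_helmholtzSol hL hk hp).neg

lemma iteratedDerivWithin_two_navierSol (hL : 0 < L) (hk : 0 < k) (hp : Continuous p) {x : ℝ}
    (hx : x ∈ Set.Icc 0 L) :
    iteratedDerivWithin 2 (navierSol L k p) (Set.Icc 0 L) x = -helmholtzSol L k p x := by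
  rw [iteratedDerivWithin_eq_iteratedDeriv (uniqueDiffOn_Icc hL)
    ((contDiff_navierSol hL hk hp).of_le (by norm_num)).contDiffAt hx]
  simp only [iteratedDeriv_succ, iteratedDeriv_zero, deriv_deriv_navierSol hL hk hp]

lemma iteratedDerivWithin_four_navierSol (hL : 0 < L) (hk : 0 < k) (hp : Continuous p) {x : ℝ}
    (hx : x ∈ Set.Icc 0 L) :
    iteratedDerivWithin 4 (navierSol L k p) (Set.Icc 0 L) x =
      p x - k ^ 2 * helmholtzSol L k p x := by
  rw [iteratedDerivWithin_eq_iteratedDeriv (uniqueDiffOn_Icc hL)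
    (contDiff_navierSol hL hk hp).contDiffAt hx]
  simp only [iteratedDeriv_succ, iteratedDeriv_zero, deriv_deriv_navierSol hL hk hp]
  simp [deriv_helmholtzSol hp, deriv_helmholtzSolDeriv hL hk hp]

lemma navierSol_sub_const_mul (hp : Continuous p) (hq : Continuous q) (r x : ℝ) :
    navierSol L k (fun s => p s - r * q s) x = navierSol L k p x - r * navierSol L k q x := by
  simp only [navierSol, poissonSol, helmholtzSol]
  rw [variationOfParams_sub_const_mul (by fun_prop) (by fun_prop) hp hq,
    variationOfParams_sub_const_mul (by fun_prop) (by fun_prop) hp hq]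
  ring

/-- A homogeneous two-point problem `f'' = m f`, `f(0) = f(L) = 0` with `m ≥ 0` has only the
trivial solution. -/
lemma eq_zero_of_second_deriv_eq_mul {m : ℝ} (hm : 0 ≤ m) {f f' f'' : ℝ → ℝ}
    (hf : ∀ x ∈ Set.Icc 0 L, HasDerivWithinAt f (f' x) (Set.Icc 0 L) x)
    (hf' : ∀ x ∈ Set.Icc 0 L, HasDerivWithinAt f' (f'' x) (Set.Icc 0 L) x)
    (heq : ∀ x ∈ Set.Ioo 0 L, f'' x = m * f x) (h0 : f 0 = 0) (h1 : f L = 0) :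
    ∀ x ∈ Set.Icc 0 L, f x = 0 := by
  have hg : ∀ x ∈ Set.Icc 0 L, HasDerivWithinAt (fun x => f x * f' x)
      (f' x * f' x + f x * f'' x) (Set.Icc 0 L) x := fun x hx => (hf x hx).mul (hf' x hx)
  have hmono : MonotoneOn (fun x => f x * f' x) (Set.Icc 0 L) := by
    refine monotoneOn_of_hasDerivWithinAt_nonneg (convex_Icc 0 L)
      (fun x hx => (hg x hx).continuousWithinAt)
      (fun x hx => (hg x (interior_subset hx)).mono interior_subset) ?_
    intro x hx
    rw [interior_Icc] at hx
    rw [heq x hx]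
    nlinarith [mul_self_nonneg (f' x), mul_nonneg hm (mul_self_nonneg (f x))]
  have hzero : ∀ x ∈ Set.Icc 0 L, f x * f' x = 0 := by
    intro x hx
    have hL := hx.1.trans hx.2
    have a := hmono (Set.left_mem_Icc.2 hL) hx hx.1
    have b := hmono hx (Set.right_mem_Icc.2 hL) hx.2
    simp only [h0, h1, zero_mul] at a b
    exact le_antisymm b a
  have hsq : ∀ x ∈ Set.Icc 0 L, HasDerivWithinAt (fun x => f x * f x) 0 (Set.Icc 0 L) x :=
    fun x hx => ((hf x hx).mul (hf x hx)).congr_deriv (by linarith [hzero x hx])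
  intro x hx
  have h := constant_of_derivWithin_zero (fun x hx => (hsq x hx).differentiableWithinAt)
    (fun x hx' => (hsq x (Set.Ico_subset_Icc_self hx')).derivWithin
      (uniqueDiffOn_Icc (hx'.1.trans_lt hx'.2) x (Set.Ico_subset_Icc_self hx'))) x hx
  simpa [h0] using h

lemma eq_navierSol (hL : 0 < L) (hk : 0 < k) (hp : Continuous p) {z : ℝ → ℝ}
    (hz : ContDiffOn ℝ 4 z (Set.Icc 0 L))
    (heq : ∀ x ∈ Set.Ioo 0 L, iteratedDerivWithin 4 z (Set.Icc 0 L) x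
      - k ^ 2 * iteratedDerivWithin 2 z (Set.Icc 0 L) x = p x)
    (h0 : z 0 = 0) (h1 : z L = 0) (h20 : iteratedDerivWithin 2 z (Set.Icc 0 L) 0 = 0)
    (h2L : iteratedDerivWithin 2 z (Set.Icc 0 L) L = 0) :
    ∀ x ∈ Set.Icc 0 L, z x = navierSol L k p x := by
  have hu : UniqueDiffOn ℝ (Set.Icc 0 L) := uniqueDiffOn_Icc hL
  have hn : ContDiffOn ℝ 4 (navierSol L k p) (Set.Icc 0 L) :=
    (contDiff_navierSol hL hk hp).contDiffOn
  set d : ℝ → ℝ := z - navierSol L k p with hd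
  have hdc : ContDiffOn ℝ 4 d (Set.Icc 0 L) := hz.sub hn
  have hstep : ∀ n : ℕ, n < 4 → ∀ x ∈ Set.Icc 0 L,
      HasDerivWithinAt (iteratedDerivWithin n d (Set.Icc 0 L))
        (iteratedDerivWithin (n + 1) d (Set.Icc 0 L) x) (Set.Icc 0 L) x := by
    intro n hn x hx
    rw [iteratedDerivWithin_succ]
    exact (hdc.differentiableOn_iteratedDerivWithin (by exact_mod_cast hn) hu x hx).hasDerivWithinAt
  have hd2 : ∀ x ∈ Set.Icc 0 L, iteratedDerivWithin 2 d (Set.Icc 0 L) x =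
      iteratedDerivWithin 2 z (Set.Icc 0 L) x + helmholtzSol L k p x := by
    intro x hx
    rw [hd, iteratedDerivWithin_sub hx hu ((hz x hx).of_le (by norm_num))
      ((hn x hx).of_le (by norm_num)), iteratedDerivWithin_two_navierSol hL hk hp hx]
    ring
  have hd4 : ∀ x ∈ Set.Icc 0 L, iteratedDerivWithin 4 d (Set.Icc 0 L) x =
      iteratedDerivWithin 4 z (Set.Icc 0 L) x - (p x - k ^ 2 * helmholtzSol L k p x) := by
    intro x hx
    rw [hd, iteratedDerivWithin_sub hx hu (hz x hx) (hn x hx),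
      iteratedDerivWithin_four_navierSol hL hk hp hx]
  have hl := Set.left_mem_Icc.2 hL.le
  have hr := Set.right_mem_Icc.2 hL.le
  have hz2 : ∀ x ∈ Set.Icc 0 L, iteratedDerivWithin 2 d (Set.Icc 0 L) x = 0 := by
    refine eq_zero_of_second_deriv_eq_mul (sq_nonneg k) (hstep 2 (by norm_num))
      (hstep 3 (by norm_num)) ?_ ?_ ?_
    · intro x hx
      have hx' := Set.Ioo_subset_Icc_self hx
      rw [hd2 x hx', hd4 x hx']
      linarith [heq x hx]
    · rw [hd2 0 hl, h20, helmholtzSol_left, add_zero]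
    · rw [hd2 L hr, h2L, helmholtzSol_right, add_zero]
  have hz0 : ∀ x ∈ Set.Icc 0 L, iteratedDerivWithin 0 d (Set.Icc 0 L) x = 0 := by
    refine eq_zero_of_second_deriv_eq_mul le_rfl (hstep 0 (by norm_num))
      (hstep 1 (by norm_num)) ?_ ?_ ?_
    · intro x hx
      simpa using hz2 x (Set.Ioo_subset_Icc_self hx)
    · simp [hd, h0, navierSol_left]
    · simp [hd, h1, navierSol_right]
  intro x hx
  have := hz0 x hx
  simp only [iteratedDerivWithin_zero, hd, Pi.sub_apply] at this
  linarith

lemma helmholtzSol_one_nonneg (hk : 0 < k) {x : ℝ} (hx : x ∈ Set.Icc 0 L) :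
    0 ≤ helmholtzSol L k (fun _ => 1) x := by
  have hs : ∀ t : ℝ, 0 ≤ t → 0 ≤ sinh (k * t) := fun t ht => sinh_nonneg_iff.2 (by positivity)
  have h1 : 0 ≤ ∫ s in (0:ℝ)..x, sinh (k * s) * 1 :=
    integral_nonneg hx.1 fun s hs' => by simpa using hs s hs'.1
  have h2 : 0 ≤ ∫ s in x..L, sinh (k * (L - s)) * 1 :=
    integral_nonneg hx.2 fun s hs' => by simpa using hs (L - s) (by linarith [hs'.2])
  have h3 := hs x hx.1
  have h4 := hs (L - x) (by linarith [hx.2])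
  have h5 := hs L (hx.1.trans hx.2)
  simp only [helmholtzSol, variationOfParams]
  positivity

lemma navierSol_one_nonneg (hL : 0 < L) (hk : 0 < k) {x : ℝ} (hx : x ∈ Set.Icc 0 L) :
    0 ≤ navierSol L k (fun _ => 1) x := by
  have hc : ConcaveOn ℝ (Set.Icc 0 L) (navierSol L k fun _ => 1) := by
    refine concaveOn_of_deriv2_nonpos' (convex_Icc 0 L)
      (differentiable_navierSol continuous_const).differentiableOn
      (differentiable_deriv_navierSol hL hk continuous_const).differentiableOn fun y hy => ?_
    simp only [Function.iterate_succ, Function.iterate_zero, Function.comp_apply, id_eq,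
      deriv_deriv_navierSol hL hk continuous_const]
    linarith [helmholtzSol_one_nonneg hk hy]
  have h := hc.ge_on_segment (Set.left_mem_Icc.2 hL.le) (Set.right_mem_Icc.2 hL.le)
    (by rwa [segment_eq_Icc hL.le])
  rwa [navierSol_left, navierSol_right, min_self] at h

lemma navierSol_one_le (hL : 0 < L) (hk : 0 < k) {x : ℝ} (hx : x ∈ Set.Icc 0 L) :
    navierSol L k (fun _ => 1) x ≤ x * (L - x) / (2 * k ^ 2) := by
  have h : poissonSol L (fun _ => 1) x = x * (L - x) / 2 := by
    simp only [poissonSol, variationOfParams, mul_one]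
    rw [integral_sub (by simp) (by simp)]
    simp only [integral_id, integral_const, smul_eq_mul]
    field_simp
    ring
  rw [navierSol, h, ← div_div]
  gcongr
  linarith [helmholtzSol_one_nonneg hk hx]

lemma integral_navierSol_one_nonneg (hL : 0 < L) (hk : 0 < k) :
    0 ≤ ∫ x in (0:ℝ)..L, navierSol L k (fun _ => 1) x :=
  integral_nonneg hL.le fun _ hx => navierSol_one_nonneg hL hk hx

lemma integral_navierSol_one_le (hL : 0 < L) (hk : 0 < k) :
    ∫ x in (0:ℝ)..L, navierSol L k (fun _ => 1) x ≤ L ^ 3 / (12 * k ^ 2) := by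
  have h : ∫ x in (0:ℝ)..L, x * (L - x) / (2 * k ^ 2) = L ^ 3 / (12 * k ^ 2) := by
    rw [integral_div]
    simp only [mul_sub]
    rw [integral_sub (Continuous.intervalIntegrable (by fun_prop) _ _)
      (Continuous.intervalIntegrable (by fun_prop) _ _), integral_mul_const]
    simp only [← pow_two, integral_pow, integral_id]
    field_simp
    norm_num
    ring
  rw [← h]
  exact integral_mono_on hL.le
    ((differentiable_navierSol continuous_const).continuous.intervalIntegrable _ _)
    (Continuous.intervalIntegrable (by fun_prop) _ _) fun x hx => navierSol_one_le hL hk hx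

end

lemma continuous_greenK (M L x : ℝ) : Continuous (GreenK M L x) := by
  unfold GreenK
  refine Continuous.if_le (by fun_prop) (by fun_prop) continuous_const continuous_id ?_
  rintro s rfl
  rfl

lemma integral_greenK_mul {L M : ℝ} (hL : 0 < L) (hM : 0 < M) {p f : ℝ → ℝ} (hf : Continuous f)
    (hpf : Set.EqOn p f (Set.Icc 0 L)) {x : ℝ} (hx : x ∈ Set.Icc 0 L) :
    ∫ s in (0:ℝ)..L, GreenK M L x s * p s = navierSol L (√M) f x := by
  have hk : 0 < √M := sqrt_pos.2 hM
  have hS : 0 < sinh (√M * L) := sinh_pos_iff.2 (by positivity)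
  have hMk : √M ^ 2 = M := sq_sqrt hM.le
  have hc : Continuous fun s => GreenK M L x s * f s := (continuous_greenK M L x).mul hf
  rw [integral_congr (g := fun s => GreenK M L x s * f s) (fun s hs => by
      rw [Set.uIcc_of_le hL.le] at hs
      simp only [hpf hs]),
    ← integral_add_adjacent_intervals (hc.intervalIntegrable 0 x) (hc.intervalIntegrable x L),
    integral_congr (a := 0) (b := x) (g := fun s => (L - x) / (M * L) * (s * f s) -
      sinh (√M * (L - x)) / (M * √M * sinh (√M * L)) * (sinh (√M * s) * f s)) (fun s hs => by
      rw [Set.uIcc_of_le hx.1] at hs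
      simp only [GreenK]
      split_ifs with h
      · obtain rfl : x = s := le_antisymm h hs.2
        ring
      · ring),
    integral_congr (a := x) (b := L) (g := fun s => x / (M * L) * ((L - s) * f s) -
      sinh (√M * x) / (M * √M * sinh (√M * L)) * (sinh (√M * (L - s)) * f s)) (fun s hs => by
      rw [Set.uIcc_of_le hx.2] at hs
      simp only [GreenK, if_pos hs.1]
      ring),
    integral_sub (Continuous.intervalIntegrable (by fun_prop) _ _)
      (Continuous.intervalIntegrable (by fun_prop) _ _),
    integral_sub (Continuous.intervalIntegrable (by fun_prop) _ _)
      (Continuous.intervalIntegrable (by fun_prop) _ _)]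
  simp only [integral_const_mul, navierSol, poissonSol, helmholtzSol,
    variationOfParams, hMk]
  field_simp
  ring

theorem stmt3 (L M N : ℝ) (hL : 0 < L) (hM : 0 < M)
    (hN : |N| ≤ 8 * M / L ^ 3)
    (p : ℝ → ℝ) (hp : ContinuousOn p (Set.Icc 0 L)) :
    ∃ y : ℝ → ℝ, IsSolutionBVP L M N p y ∧
      (∀ x ∈ Set.Icc (0:ℝ) L,
        y x = (∫ s in (0:ℝ)..L, GreenK M L x s * p s)
          - (N * ∫ s in (0:ℝ)..L, GreenK M L x s) /
              (1 + N * ∫ x in (0:ℝ)..L, ∫ s in (0:ℝ)..L, GreenK M L x s)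
            * ∫ x in (0:ℝ)..L, ∫ s in (0:ℝ)..L, GreenK M L x s * p s) ∧
      (∀ z : ℝ → ℝ, IsSolutionBVP L M N p z →
        ∀ x ∈ Set.Icc (0:ℝ) L, z x = y x) := by
  have hk : 0 < √M := sqrt_pos.2 hM
  have hMk : √M ^ 2 = M := sq_sqrt hM.le
  obtain ⟨f, hf, hpf⟩ : ∃ f : ℝ → ℝ, Continuous f ∧ Set.EqOn p f (Set.Icc 0 L) :=
    ⟨Set.IccExtend hL.le ((Set.Icc 0 L).domRestrict p), hp.domRestrict.Icc_extend',
      fun x hx => by rw [Set.IccExtend_of_mem _ _ hx]; rfl⟩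
  have hGp : ∀ x ∈ Set.Icc 0 L, ∫ s in (0:ℝ)..L, GreenK M L x s * p s = navierSol L (√M) f x :=
    fun x hx => integral_greenK_mul hL hM hf hpf hx
  have hG1 : ∀ x ∈ Set.Icc 0 L, ∫ s in (0:ℝ)..L, GreenK M L x s =
      navierSol L (√M) (fun _ => 1) x := fun x hx => by
    simpa using integral_greenK_mul hL hM (p := fun _ => 1) continuous_const
      (fun _ _ => rfl) hx
  have hIp : ∫ x in (0:ℝ)..L, ∫ s in (0:ℝ)..L, GreenK M L x s * p s =
      ∫ x in (0:ℝ)..L, navierSol L (√M) f x :=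
    integral_congr fun x hx => hGp x (by rwa [Set.uIcc_of_le hL.le] at hx)
  have hI1 : ∫ x in (0:ℝ)..L, ∫ s in (0:ℝ)..L, GreenK M L x s =
      ∫ x in (0:ℝ)..L, navierSol L (√M) (fun _ => 1) x :=
    integral_congr fun x hx => hG1 x (by rwa [Set.uIcc_of_le hL.le] at hx)
  rw [hIp, hI1]
  have hD0 := integral_navierSol_one_nonneg hL hk
  have hD1 := integral_navierSol_one_le hL hk
  rw [hMk] at hD1
  have hint : ∀ r : ℝ, ∫ x in (0:ℝ)..L, navierSol L (√M) (fun s => f s - r * 1) x =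
      (∫ x in (0:ℝ)..L, navierSol L (√M) f x) -
        r * ∫ x in (0:ℝ)..L, navierSol L (√M) (fun _ => 1) x := by
    intro r
    simp only [navierSol_sub_const_mul hf continuous_const]
    have c1 := (differentiable_navierSol (L := L) (k := √M) hf).continuous
    have c2 := (differentiable_navierSol (L := L) (k := √M) (p := fun _ => 1)
      continuous_const).continuous
    rw [integral_sub (c1.intervalIntegrable _ _) ((c2.intervalIntegrable _ _).const_mul r),
      integral_const_mul]
  set D := ∫ x in (0:ℝ)..L, navierSol L (√M) (fun _ => 1) x
  set P := ∫ x in (0:ℝ)..L, navierSol L (√M) f x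
  have hND : |N * D| ≤ 2 / 3 := by
    rw [abs_mul, abs_of_nonneg hD0]
    calc |N| * D ≤ (8 * M / L ^ 3) * (L ^ 3 / (12 * M)) := by gcongr
      _ = 2 / 3 := by field_simp; norm_num
  have hne : 1 + N * D ≠ 0 := by
    have := (abs_le.1 hND).1
    intro h
    linarith
  have hcont : ∀ r : ℝ, Continuous fun s => f s - r * 1 := fun r => by fun_prop
  have hC : P - N * (P / (1 + N * D)) * D = P / (1 + N * D) := by
    field_simp
    ring
  refine ⟨navierSol L (√M) (fun s => f s - N * (P / (1 + N * D)) * 1),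
    ⟨(contDiff_navierSol hL hk (hcont _)).contDiffOn, ?_, navierSol_left, navierSol_right, ?_, ?_⟩,
    ?_, ?_⟩
  · intro x hx
    have hx' := Set.Ioo_subset_Icc_self hx
    rw [iteratedDerivWithin_two_navierSol hL hk (hcont _) hx',
      iteratedDerivWithin_four_navierSol hL hk (hcont _) hx', hint, hC, hMk, hpf hx']
    ring
  · rw [iteratedDerivWithin_two_navierSol hL hk (hcont _) (Set.left_mem_Icc.2 hL.le),
      helmholtzSol_left, neg_zero]
  · rw [iteratedDerivWithin_two_navierSol hL hk (hcont _) (Set.right_mem_Icc.2 hL.le),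
      helmholtzSol_right, neg_zero]
  · intro x hx
    rw [hGp x hx, hG1 x hx, navierSol_sub_const_mul hf continuous_const]
    ring
  · rintro z ⟨hz, heq, h0, h1, h20, h2L⟩ x hx
    have hzs := eq_navierSol hL hk (hcont (N * ∫ t in (0:ℝ)..L, z t)) hz (fun y hy => by
      rw [hMk, ← hpf (Set.Ioo_subset_Icc_self hy)]
      linarith [heq y hy]) h0 h1 h20 h2L
    have hZ : ∫ t in (0:ℝ)..L, z t = P - N * (∫ t in (0:ℝ)..L, z t) * D := by
      rw [← hint]
      exact integral_congr fun t ht => hzs t (by rwa [Set.uIcc_of_le hL.le] at ht)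
    have hZ' : ∫ t in (0:ℝ)..L, z t = P / (1 + N * D) := by
      rw [eq_div_iff hne]
      linarith
    rw [hzs x hx, hZ']
end

section
/- Let L > 0 be a real number. Then for all constants M > 0 and N > 0 and every continuous function p : [0,L] → ℝ, the nonlocal boundary value problem y''''(x) − M·y''(x) + N·∫₀ᴸ y(t)dt = p(x) for x ∈ (0,L), with y(0) = y(L) = y''(0) = y''(L) = 0, has a unique solution y of class C⁴ on [0,L], given explicitly by y(x) = ∫₀ᴸ G(x,s)p(s)ds − (N·∫₀ᴸ G(x,s)ds)/(1 + N·∫₀ᴸ∫₀ᴸ G(x,s)ds dx) · ∫₀ᴸ∫₀ᴸ G(x,s)p(s)ds dx for x ∈ [0,L]. -/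
open Real

open Set in
/-- A homogeneous solution of the nonlocal problem, given together with its derivatives, vanishes. -/
theorem eq_zero_of_homogeneous {L M N : ℝ} (hL : 0 < L) (hM : 0 < M) (hN : 0 < N)
    {d d1 d2 d3 d4 : ℝ → ℝ}
    (c0 : ContinuousOn d (Icc 0 L)) (c1 : ContinuousOn d1 (Icc 0 L))
    (c2 : ContinuousOn d2 (Icc 0 L)) (c3 : ContinuousOn d3 (Icc 0 L))
    (h0 : ∀ x ∈ Ioo 0 L, HasDerivAt d (d1 x) x) (h1 : ∀ x ∈ Ioo 0 L, HasDerivAt d1 (d2 x) x)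
    (h2 : ∀ x ∈ Ioo 0 L, HasDerivAt d2 (d3 x) x) (h3 : ∀ x ∈ Ioo 0 L, HasDerivAt d3 (d4 x) x)
    (heq : ∀ x ∈ Ioo 0 L, d4 x - M * d2 x + N * (∫ t in (0:ℝ)..L, d t) = 0)
    (b0 : d 0 = 0) (bL : d L = 0) (b20 : d2 0 = 0) (b2L : d2 L = 0) :
    ∀ x ∈ Icc 0 L, d x = 0 := by
  set I := ∫ t in (0:ℝ)..L, d t with hI
  set e : ℝ → ℝ := IccExtend hL.le ((Icc 0 L).domRestrict d) with he
  have hec : Continuous e := (continuousOn_iff_continuous_domRestrict.mp c0).Icc_extend'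
  have hed : ∀ x ∈ Icc 0 L, e x = d x := fun x hx => by
    rw [he, IccExtend_of_mem hL.le _ hx]; rfl
  set J : ℝ → ℝ := fun x => ∫ t in (0:ℝ)..x, e t with hJ
  have hJd : ∀ x, HasDerivAt J (e x) x := fun x => hec.integral_hasStrictDerivAt 0 x |>.hasDerivAt
  have hJc : Continuous J := continuous_iff_continuousAt.mpr fun x => (hJd x).continuousAt
  have hJL : J L = I := by
    refine intervalIntegral.integral_congr fun x hx => ?_
    rw [uIcc_of_le hL.le] at hx
    exact hed x hx
  set F : ℝ → ℝ := fun x => d3 x * d x - d2 x * d1 x - M * (d1 x * d x) + N * I * J x with hF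
  have hFc : ContinuousOn F (Icc 0 L) :=
    (((c3.mul c0).sub (c2.mul c1)).sub (continuousOn_const.mul (c1.mul c0))).add
      (continuousOn_const.mul hJc.continuousOn)
  have hFd : ∀ x ∈ Ioo 0 L, HasDerivAt F (-(d2 x ^ 2 + M * d1 x ^ 2)) x := fun x hx => by
    have h := ((((h3 x hx).mul (h0 x hx)).sub ((h2 x hx).mul (h1 x hx))).sub
      (((h1 x hx).mul (h0 x hx)).const_mul M)).add ((hJd x).const_mul (N * I))
    refine h.congr_deriv ?_
    rw [hed x (Ioo_subset_Icc_self hx)]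
    linear_combination d x * heq x hx
  have hFanti : AntitoneOn F (Icc 0 L) := by
    refine antitoneOn_of_deriv_nonpos (convex_Icc 0 L) hFc ?_ ?_
    · rw [interior_Icc]
      exact fun x hx => (hFd x hx).differentiableAt.differentiableWithinAt
    · rw [interior_Icc]
      intro x hx
      rw [(hFd x hx).deriv]
      have := mul_nonneg hM.le (sq_nonneg (d1 x))
      nlinarith [sq_nonneg (d2 x)]
  have hF0 : F 0 = 0 := by simp [hF, hJ, b0, b20]
  have hFL : 0 ≤ F L := by
    have : F L = N * I ^ 2 := by simp only [hF, hJL, bL, b2L]; ring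
    rw [this]; positivity
  have hFzero : ∀ x ∈ Icc 0 L, F x = 0 := fun x hx => by
    refine le_antisymm ?_ (hFL.trans (hFanti hx ⟨hL.le, le_rfl⟩ hx.2))
    exact (hFanti ⟨le_rfl, hL.le⟩ hx hx.1).trans hF0.le
  have hd1 : ∀ x ∈ Ioo 0 L, d1 x = 0 := fun x hx => by
    have hev : F =ᶠ[nhds x] fun _ => 0 := by
      filter_upwards [Icc_mem_nhds hx.1 hx.2] with t ht using hFzero t ht
    have h := (hFd x hx).unique ((hasDerivAt_const x (0:ℝ)).congr_of_eventuallyEq hev)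
    have hz : M * d1 x ^ 2 = 0 :=
      le_antisymm (by nlinarith [sq_nonneg (d2 x)]) (mul_nonneg hM.le (sq_nonneg _))
    simpa [hM.ne'] using hz
  intro x hx
  rcases hx.1.eq_or_lt with rfl | hx0
  · exact b0
  · obtain ⟨c, hc, hcd⟩ := exists_hasDerivAt_eq_slope d d1 hx0
      (c0.mono (Icc_subset_Icc_right hx.2))
      (fun t ht => h0 t ⟨ht.1, ht.2.trans_le hx.2⟩)
    rw [hd1 c ⟨hc.1, hc.2.trans_le hx.2⟩, b0, sub_zero, sub_zero, eq_comm,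
      div_eq_zero_iff] at hcd
    exact hcd.resolve_right hx0.ne'

/-- `u` solves the linear equation with right-hand side `f` and Navier boundary conditions on
`[0, L]`, and `u1`, `u2`, `u3` are its first three derivatives. -/
structure IsNavierSolution (L M : ℝ) (f u u1 u2 u3 : ℝ → ℝ) : Prop where
  deriv0 : ∀ x, HasDerivAt u (u1 x) x
  deriv1 : ∀ x, HasDerivAt u1 (u2 x) x
  deriv2 : ∀ x, HasDerivAt u2 (u3 x) x
  deriv3 : ∀ x, HasDerivAt u3 (M * u2 x + f x) x
  left : u 0 = 0
  right : u L = 0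
  left2 : u2 0 = 0
  right2 : u2 L = 0

theorem IsNavierSolution.continuous {L M : ℝ} {f u u1 u2 u3 : ℝ → ℝ}
    (h : IsNavierSolution L M f u u1 u2 u3) :
    Continuous u ∧ Continuous u1 ∧ Continuous u2 ∧ Continuous u3 :=
  ⟨continuous_iff_continuousAt.mpr fun x => (h.deriv0 x).continuousAt,
    continuous_iff_continuousAt.mpr fun x => (h.deriv1 x).continuousAt,
    continuous_iff_continuousAt.mpr fun x => (h.deriv2 x).continuousAt,
    continuous_iff_continuousAt.mpr fun x => (h.deriv3 x).continuousAt⟩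

theorem IsNavierSolution.sub_const_mul {L M c : ℝ} {f u u1 u2 u3 g v v1 v2 v3 : ℝ → ℝ}
    (h : IsNavierSolution L M f u u1 u2 u3) (k : IsNavierSolution L M g v v1 v2 v3) :
    IsNavierSolution L M (fun x => f x - c * g x) (fun x => u x - c * v x)
      (fun x => u1 x - c * v1 x) (fun x => u2 x - c * v2 x) (fun x => u3 x - c * v3 x) where
  deriv0 x := (h.deriv0 x).sub ((k.deriv0 x).const_mul c)
  deriv1 x := (h.deriv1 x).sub ((k.deriv1 x).const_mul c)
  deriv2 x := (h.deriv2 x).sub ((k.deriv2 x).const_mul c)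
  deriv3 x := ((h.deriv3 x).sub ((k.deriv3 x).const_mul c)).congr_deriv (by ring)
  left := by simp [h.left, k.left]
  right := by simp [h.right, k.right]
  left2 := by simp [h.left2, k.left2]
  right2 := by simp [h.right2, k.right2]

theorem IsNavierSolution.contDiff {L M : ℝ} {f u u1 u2 u3 : ℝ → ℝ}
    (h : IsNavierSolution L M f u u1 u2 u3) (hf : Continuous f) : ContDiff ℝ 4 u := by
  have step : ∀ (n : ℕ) {v w : ℝ → ℝ}, (∀ x, HasDerivAt v (w x) x) → ContDiff ℝ n w →
      ContDiff ℝ (n + 1 : ℕ) v := fun n v w hv hw => by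
    push_cast
    refine contDiff_succ_iff_deriv.mpr ⟨fun x => (hv x).differentiableAt, by simp, ?_⟩
    rwa [show deriv v = w from funext fun x => (hv x).deriv]
  have c4 : ContDiff ℝ (0 : ℕ) fun x => M * u2 x + f x := by
    have := h.continuous.2.2.1
    exact contDiff_zero.mpr (by fun_prop)
  exact step 3 h.deriv0 (step 2 h.deriv1 (step 1 h.deriv2 (step 0 h.deriv3 c4)))

theorem IsNavierSolution.iteratedDeriv_two {L M : ℝ} {f u u1 u2 u3 : ℝ → ℝ}
    (h : IsNavierSolution L M f u u1 u2 u3) : iteratedDeriv 2 u = u2 := by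
  rw [iteratedDeriv_succ, iteratedDeriv_one,
    show deriv u = u1 from funext fun x => (h.deriv0 x).deriv]
  exact funext fun x => (h.deriv1 x).deriv

theorem IsNavierSolution.iteratedDeriv_four {L M : ℝ} {f u u1 u2 u3 : ℝ → ℝ}
    (h : IsNavierSolution L M f u u1 u2 u3) : iteratedDeriv 4 u = fun x => M * u2 x + f x := by
  rw [iteratedDeriv_succ, iteratedDeriv_succ, h.iteratedDeriv_two,
    show deriv u2 = u3 from funext fun x => (h.deriv2 x).deriv]
  exact funext fun x => (h.deriv3 x).deriv

theorem GreenK_of_ge {M L x s : ℝ} (h : s ≤ x) :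
    GreenK M L x s = s * (L - x) / (M * L) -
      Real.sinh (Real.sqrt M * s) * Real.sinh (Real.sqrt M * (L - x)) /
        (M * Real.sqrt M * Real.sinh (Real.sqrt M * L)) := by
  rcases h.eq_or_lt with rfl | h
  · simp [GreenK]
  · rw [GreenK, if_neg h.not_ge]

theorem continuous_GreenK (M L x : ℝ) : Continuous fun s => GreenK M L x s := by
  unfold GreenK
  refine Continuous.if_le (by fun_prop) (by fun_prop) continuous_const continuous_id ?_
  rintro s rfl
  rfl

open Set in
/-- The Green function solves the linear problem. -/
theorem exists_isNavierSolution {L M : ℝ} (hL : 0 < L) (hM : 0 < M) {f : ℝ → ℝ}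
    (hf : Continuous f) :
    ∃ u u1 u2 u3 : ℝ → ℝ, IsNavierSolution L M f u u1 u2 u3 ∧
      ∀ x ∈ Icc 0 L, u x = ∫ s in (0:ℝ)..L, GreenK M L x s * f s := by
  obtain ⟨k, hk⟩ : ∃ k, k = Real.sqrt M := ⟨_, rfl⟩
  have hk0 : 0 < k := hk ▸ Real.sqrt_pos.mpr hM
  have hkM : M = k ^ 2 := by rw [hk, Real.sq_sqrt hM.le]
  obtain ⟨S, hS⟩ : ∃ S, S = Real.sinh (k * L) := ⟨_, rfl⟩
  have hS0 : 0 < S := hS ▸ Real.sinh_pos_iff.mpr (by positivity)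
  have fwd : ∀ g : ℝ → ℝ, Continuous g → ∀ x, HasDerivAt (fun x => ∫ s in (0:ℝ)..x, g s) (g x) x :=
    fun g hg x => (hg.integral_hasStrictDerivAt 0 x).hasDerivAt
  have bwd : ∀ g : ℝ → ℝ, Continuous g → ∀ x, HasDerivAt (fun x => ∫ s in x..L, g s) (-g x) x :=
    fun g hg x => intervalIntegral.integral_hasDerivAt_left (hg.intervalIntegrable _ _)
      (hg.stronglyMeasurableAtFilter _ _) hg.continuousAt
  obtain ⟨A, hA⟩ : ∃ A : ℝ → ℝ, A = fun x => ∫ s in (0:ℝ)..x, s * f s := ⟨_, rfl⟩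
  obtain ⟨B, hB⟩ : ∃ B : ℝ → ℝ, B = fun x => ∫ s in x..L, (L - s) * f s := ⟨_, rfl⟩
  obtain ⟨C, hC⟩ : ∃ C : ℝ → ℝ, C = fun x => ∫ s in (0:ℝ)..x, Real.sinh (k * s) * f s := ⟨_, rfl⟩
  obtain ⟨D, hD⟩ : ∃ D : ℝ → ℝ, D = fun x => ∫ s in x..L, Real.sinh (k * (L - s)) * f s :=
    ⟨_, rfl⟩
  have dA : ∀ x, HasDerivAt A (x * f x) x := hA ▸ fwd _ (by fun_prop)
  have dB : ∀ x, HasDerivAt B (-((L - x) * f x)) x := hB ▸ bwd _ (by fun_prop)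
  have dC : ∀ x, HasDerivAt C (Real.sinh (k * x) * f x) x := hC ▸ fwd _ (by fun_prop)
  have dD : ∀ x, HasDerivAt D (-(Real.sinh (k * (L - x)) * f x)) x := hD ▸ bwd _ (by fun_prop)
  have A0 : A 0 = 0 := by simp [hA]
  have C0 : C 0 = 0 := by simp [hC]
  have BL : B L = 0 := by simp [hB]
  have DL : D L = 0 := by simp [hD]
  have lin : ∀ x, HasDerivAt (fun x => k * x) k x := fun x => by
    simpa using (hasDerivAt_id x).const_mul k
  have rev : ∀ x, HasDerivAt (fun x => L - x) (-1) x := fun x => (hasDerivAt_id x).const_sub L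
  have linrev : ∀ x, HasDerivAt (fun x => k * (L - x)) (-k) x := fun x => by
    simpa using (rev x).const_mul k
  have sinh_sum : ∀ x, Real.sinh (k * (L - x)) * Real.cosh (k * x) +
      Real.cosh (k * (L - x)) * Real.sinh (k * x) = S := fun x => by
    rw [← Real.sinh_add, hS]; congr 1; ring
  have dE : ∀ x, HasDerivAt
      (fun x => Real.sinh (k * (L - x)) * C x + Real.sinh (k * x) * D x)
      (k * (Real.cosh (k * x) * D x - Real.cosh (k * (L - x)) * C x)) x := fun x => by
    refine (((linrev x).sinh.mul (dC x)).add ((lin x).sinh.mul (dD x))).congr_deriv ?_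
    ring
  have dE1 : ∀ x, HasDerivAt
      (fun x => k * (Real.cosh (k * x) * D x - Real.cosh (k * (L - x)) * C x))
      (k ^ 2 * (Real.sinh (k * (L - x)) * C x + Real.sinh (k * x) * D x) - k * S * f x) x :=
    fun x => by
    refine ((((lin x).cosh.mul (dD x)).sub ((linrev x).cosh.mul (dC x))).const_mul k).congr_deriv ?_
    linear_combination (-k * f x) * sinh_sum x
  have dW : ∀ x, HasDerivAt (fun x => (L - x) * A x + x * B x) (B x - A x) x := fun x => by
    refine (((rev x).mul (dA x)).add ((hasDerivAt_id x).mul (dB x))).congr_deriv ?_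
    simp only [id]
    ring
  have dW1 : ∀ x, HasDerivAt (fun x => B x - A x) (-(L * f x)) x := fun x =>
    ((dB x).sub (dA x)).congr_deriv (by ring)
  refine ⟨fun x => ((L - x) * A x + x * B x) / (M * L) -
      (Real.sinh (k * (L - x)) * C x + Real.sinh (k * x) * D x) / (M * k * S),
    fun x => (B x - A x) / (M * L) -
      (k * (Real.cosh (k * x) * D x - Real.cosh (k * (L - x)) * C x)) / (M * k * S),
    fun x => -((Real.sinh (k * (L - x)) * C x + Real.sinh (k * x) * D x) / (k * S)),
    fun x => -((k * (Real.cosh (k * x) * D x - Real.cosh (k * (L - x)) * C x)) / (k * S)),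
    ⟨fun x => ((dW x).div_const _).sub ((dE x).div_const _), fun x => ?_,
      fun x => ((dE x).div_const _).neg, fun x => ?_, ?_, ?_, ?_, ?_⟩, fun x hx => ?_⟩
  · refine (((dW1 x).div_const _).sub ((dE1 x).div_const _)).congr_deriv ?_
    rw [hkM]
    field_simp
    ring
  · refine ((dE1 x).div_const _).neg.congr_deriv ?_
    rw [hkM]
    field_simp
    ring
  · simp [A0, C0]
  · simp [BL, DL]
  · simp [C0]
  · simp [DL]
  · have hG : Continuous fun s => GreenK M L x s * f s := (continuous_GreenK M L x).mul hf
    rw [← intervalIntegral.integral_add_adjacent_intervals (hG.intervalIntegrable 0 x)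
      (hG.intervalIntegrable x L)]
    have e1 : ∫ s in (0:ℝ)..x, GreenK M L x s * f s =
        (L - x) / (M * L) * A x - Real.sinh (k * (L - x)) / (M * k * S) * C x := by
      rw [hA, hC, ← intervalIntegral.integral_const_mul, ← intervalIntegral.integral_const_mul,
        ← intervalIntegral.integral_sub (Continuous.intervalIntegrable (by fun_prop) _ _)
          (Continuous.intervalIntegrable (by fun_prop) _ _)]
      refine intervalIntegral.integral_congr fun s hs => ?_
      rw [uIcc_of_le hx.1] at hs
      simp only [GreenK_of_ge hs.2, ← hk, ← hS]
      ring
    have e2 : ∫ s in x..L, GreenK M L x s * f s =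
        x / (M * L) * B x - Real.sinh (k * x) / (M * k * S) * D x := by
      rw [hB, hD, ← intervalIntegral.integral_const_mul, ← intervalIntegral.integral_const_mul,
        ← intervalIntegral.integral_sub (Continuous.intervalIntegrable (by fun_prop) _ _)
          (Continuous.intervalIntegrable (by fun_prop) _ _)]
      refine intervalIntegral.integral_congr fun s hs => ?_
      rw [uIcc_of_le hx.2] at hs
      simp only [GreenK, if_pos hs.1, ← hk, ← hS]
      ring
    rw [e1, e2]
    ring

open Set in
/-- A solution of the nonlocal problem agrees with any linear solution whose right-hand side
absorbs the nonlocal term. -/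
theorem IsSolutionBVP.eq_of_isNavierSolution {L M N : ℝ} (hL : 0 < L) (hM : 0 < M) (hN : 0 < N)
    {p z f u u1 u2 u3 : ℝ → ℝ} (hz : IsSolutionBVP L M N p z)
    (hu : IsNavierSolution L M f u u1 u2 u3)
    (hf : ∀ x ∈ Ioo 0 L, f x + N * (∫ t in (0:ℝ)..L, u t) = p x) :
    ∀ x ∈ Icc 0 L, z x = u x := by
  obtain ⟨zc, zeq, z0, zL, z20, z2L⟩ := hz
  obtain ⟨uc, u1c, u2c, u3c⟩ := hu.continuous
  have hud : UniqueDiffOn ℝ (Icc 0 L) := uniqueDiffOn_Icc hL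
  have zcont : ∀ m : ℕ, m ≤ 4 → ContinuousOn (iteratedDerivWithin m z (Icc 0 L)) (Icc 0 L) :=
    fun m hm => zc.continuousOn_iteratedDerivWithin (by exact_mod_cast hm) hud
  have zder : ∀ m : ℕ, m < 4 → ∀ x ∈ Ioo 0 L, HasDerivAt (iteratedDerivWithin m z (Icc 0 L))
      (iteratedDerivWithin (m + 1) z (Icc 0 L) x) x := fun m hm x hx => by
    have hd := zc.differentiableOn_iteratedDerivWithin (m := m) (by exact_mod_cast hm) hud x
      (Ioo_subset_Icc_self hx)
    rw [iteratedDerivWithin_succ]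
    exact hd.hasDerivWithinAt.hasDerivAt (Icc_mem_nhds hx.1 hx.2)
  have key := eq_zero_of_homogeneous hL hM hN
    (d := fun x => z x - u x)
    (d1 := fun x => iteratedDerivWithin 1 z (Icc 0 L) x - u1 x)
    (d2 := fun x => iteratedDerivWithin 2 z (Icc 0 L) x - u2 x)
    (d3 := fun x => iteratedDerivWithin 3 z (Icc 0 L) x - u3 x)
    (d4 := fun x => iteratedDerivWithin 4 z (Icc 0 L) x - (M * u2 x + f x))
    (zc.continuousOn.sub uc.continuousOn) ((zcont 1 (by norm_num)).sub u1c.continuousOn)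
    ((zcont 2 (by norm_num)).sub u2c.continuousOn) ((zcont 3 (by norm_num)).sub u3c.continuousOn)
    (fun x hx => by
      have := zder 0 (by norm_num) x hx
      rw [iteratedDerivWithin_zero] at this
      exact this.sub (hu.deriv0 x))
    (fun x hx => (zder 1 (by norm_num) x hx).sub (hu.deriv1 x))
    (fun x hx => (zder 2 (by norm_num) x hx).sub (hu.deriv2 x))
    (fun x hx => (zder 3 (by norm_num) x hx).sub (hu.deriv3 x))
    (fun x hx => by
      rw [intervalIntegral.integral_sub
        (zc.continuousOn.intervalIntegrable_of_Icc hL.le) (uc.intervalIntegrable _ _)]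
      linear_combination zeq x hx - hf x hx)
    (by simp [z0, hu.left]) (by simp [zL, hu.right]) (by simp [z20, hu.left2])
    (by simp [z2L, hu.right2])
  exact fun x hx => sub_eq_zero.mp (key x hx)

open Set in
theorem IsNavierSolution.isSolutionBVP {L M N : ℝ} (hL : 0 < L)
    {p f u u1 u2 u3 : ℝ → ℝ} (hf : Continuous f)
    (hu : IsNavierSolution L M f u u1 u2 u3)
    (hp : ∀ x ∈ Ioo 0 L, f x + N * (∫ t in (0:ℝ)..L, u t) = p x) :
    IsSolutionBVP L M N p u := by
  have hc := hu.contDiff hf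
  have hud : UniqueDiffOn ℝ (Icc 0 L) := uniqueDiffOn_Icc hL
  have h2 : ∀ x ∈ Icc 0 L, iteratedDerivWithin 2 u (Icc 0 L) x = u2 x := fun x hx => by
    rw [iteratedDerivWithin_eq_iteratedDeriv hud (hc.contDiffAt.of_le (by norm_num)) hx,
      hu.iteratedDeriv_two]
  have h4 : ∀ x ∈ Icc 0 L, iteratedDerivWithin 4 u (Icc 0 L) x = M * u2 x + f x := fun x hx => by
    rw [iteratedDerivWithin_eq_iteratedDeriv hud hc.contDiffAt hx, hu.iteratedDeriv_four]
  refine ⟨hc.contDiffOn, fun x hx => ?_, hu.left, hu.right, ?_, ?_⟩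
  · rw [h2 x (Ioo_subset_Icc_self hx), h4 x (Ioo_subset_Icc_self hx)]
    linear_combination hp x hx
  · rw [h2 0 ⟨le_rfl, hL.le⟩, hu.left2]
  · rw [h2 L ⟨hL.le, le_rfl⟩, hu.right2]

theorem stmt4 (L : ℝ) (hL : 0 < L) :
    ∀ M N : ℝ, 0 < M → 0 < N →
    ∀ p : ℝ → ℝ, ContinuousOn p (Set.Icc 0 L) →
    ∃ y : ℝ → ℝ, IsSolutionBVP L M N p y ∧
      (∀ x ∈ Set.Icc (0:ℝ) L,
        y x = (∫ s in (0:ℝ)..L, GreenK M L x s * p s)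
          - (N * ∫ s in (0:ℝ)..L, GreenK M L x s) /
              (1 + N * ∫ x in (0:ℝ)..L, ∫ s in (0:ℝ)..L, GreenK M L x s)
            * ∫ x in (0:ℝ)..L, ∫ s in (0:ℝ)..L, GreenK M L x s * p s) ∧
      (∀ z : ℝ → ℝ, IsSolutionBVP L M N p z →
        ∀ x ∈ Set.Icc (0:ℝ) L, z x = y x) := by
  intro M N hM hN p hp
  obtain ⟨P, hP⟩ : ∃ P : ℝ → ℝ, P = Set.IccExtend hL.le ((Set.Icc 0 L).domRestrict p) := ⟨_, rfl⟩
  have hPc : Continuous P := hP ▸ (continuousOn_iff_continuous_domRestrict.mp hp).Icc_extend'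
  have hPp : ∀ x ∈ Set.Icc 0 L, P x = p x := fun x hx => by
    rw [hP, Set.IccExtend_of_mem hL.le _ hx]; rfl
  obtain ⟨u, u1, u2, u3, hu, hug⟩ := exists_isNavierSolution hL hM hPc
  obtain ⟨w, w1, w2, w3, hw, hwg⟩ := exists_isNavierSolution hL hM
    (continuous_const (y := (1 : ℝ)))
  have hug' : ∀ x ∈ Set.Icc 0 L, ∫ s in (0:ℝ)..L, GreenK M L x s * p s = u x := fun x hx => by
    rw [hug x hx]
    refine intervalIntegral.integral_congr fun s hs => ?_
    rw [Set.uIcc_of_le hL.le] at hs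
    simp only [hPp s hs]
  have hwg' : ∀ x ∈ Set.Icc 0 L, ∫ s in (0:ℝ)..L, GreenK M L x s = w x := fun x hx => by
    simp [hwg x hx]
  have hU : ∫ x in (0:ℝ)..L, ∫ s in (0:ℝ)..L, GreenK M L x s * p s = ∫ x in (0:ℝ)..L, u x :=
    intervalIntegral.integral_congr fun x hx => hug' x (by rwa [Set.uIcc_of_le hL.le] at hx)
  have hW : ∫ x in (0:ℝ)..L, ∫ s in (0:ℝ)..L, GreenK M L x s = ∫ x in (0:ℝ)..L, w x :=
    intervalIntegral.integral_congr fun x hx => hwg' x (by rwa [Set.uIcc_of_le hL.le] at hx)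
  have hden : 1 + N * ∫ x in (0:ℝ)..L, w x ≠ 0 := fun h => by
    have hzero : IsSolutionBVP L M N (fun _ => 0) w := hw.isSolutionBVP hL continuous_const
      fun x _ => h
    have hnull : IsNavierSolution L M (fun _ => 0) (fun _ => 0) (fun _ => 0) (fun _ => 0)
        (fun _ => 0) := by
      constructor <;> simp [hasDerivAt_const]
    have hw0 := hzero.eq_of_isNavierSolution hL hM hN hnull (by simp)
    have : ∫ x in (0:ℝ)..L, w x = ∫ x in (0:ℝ)..L, (0:ℝ) :=
      intervalIntegral.integral_congr fun x hx => hw0 x (by rwa [Set.uIcc_of_le hL.le] at hx)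
    simp [this] at h
  rw [hU, hW]
  set U := ∫ x in (0:ℝ)..L, u x with hUdef
  set W := ∫ x in (0:ℝ)..L, w x with hWdef
  have hy := hu.sub_const_mul (c := N * U / (1 + N * W)) hw
  have hyint : ∫ x in (0:ℝ)..L, (u x - N * U / (1 + N * W) * w x) =
      U - N * U / (1 + N * W) * W := by
    rw [intervalIntegral.integral_sub (hu.continuous.1.intervalIntegrable _ _)
      ((hw.continuous.1.const_mul _).intervalIntegrable _ _), intervalIntegral.integral_const_mul]
  have hyp : ∀ x ∈ Set.Ioo 0 L, P x - N * U / (1 + N * W) * 1 +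
      N * (∫ x in (0:ℝ)..L, (u x - N * U / (1 + N * W) * w x)) = p x := fun x hx => by
    rw [hyint, ← hPp x (Set.Ioo_subset_Icc_self hx)]
    field_simp
    ring
  refine ⟨_, hy.isSolutionBVP hL (by fun_prop) hyp, fun x hx => ?_, fun z hz =>
    hz.eq_of_isNavierSolution hL hM hN hy hyp⟩
  rw [hug' x hx, hwg' x hx]
  ring
end

section
/- Let L > 0 and M > 0 be real numbers. Then ∫₀ᴸ ∫₀ᴸ G(x,s) ds dx = [ (√M·L)³·sinh(√M·L) + 24·(cosh(√M·L) − 1) − 12·√M·L·sinh(√M·L) ] / (12·M²·√M·sinh(√M·L)). -/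
open Real

theorem hasDerivAt_cosh_mul_div {k : ℝ} (hk : k ≠ 0) (s : ℝ) :
    HasDerivAt (fun s => Real.cosh (k * s) / k) (Real.sinh (k * s)) s := by
  have h := (((hasDerivAt_id s).const_mul k).cosh).div_const k
  exact h.congr_deriv (by simp [hk])

theorem hasDerivAt_neg_cosh_mul_sub_div {k : ℝ} (hk : k ≠ 0) (L s : ℝ) :
    HasDerivAt (fun s => -(Real.cosh (k * (L - s)) / k)) (Real.sinh (k * (L - s))) s := by
  have h := (((((hasDerivAt_id s).const_sub L).const_mul k).cosh).div_const k).neg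
  exact h.congr_deriv (by simp; field_simp)

theorem integral_const_mul_id (c a b : ℝ) : (∫ s in a..b, c * s) = c * ((b ^ 2 - a ^ 2) / 2) := by
  rw [intervalIntegral.integral_const_mul c fun s => s, integral_id]

theorem integral_sinh_mul {k : ℝ} (hk : k ≠ 0) (a b : ℝ) :
    (∫ s in a..b, Real.sinh (k * s)) = (Real.cosh (k * b) - Real.cosh (k * a)) / k := by
  rw [intervalIntegral.integral_eq_sub_of_hasDerivAt
    (fun s _ => hasDerivAt_cosh_mul_div hk s)
    ((by fun_prop : Continuous fun s : ℝ => Real.sinh (k * s)).intervalIntegrable _ _)]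
  ring

theorem integral_sinh_mul_sub {k : ℝ} (hk : k ≠ 0) (L a b : ℝ) :
    (∫ s in a..b, Real.sinh (k * (L - s))) =
      (Real.cosh (k * (L - a)) - Real.cosh (k * (L - b))) / k := by
  rw [intervalIntegral.integral_eq_sub_of_hasDerivAt
    (fun s _ => hasDerivAt_neg_cosh_mul_sub_div hk L s)
    ((by fun_prop : Continuous fun s : ℝ => Real.sinh (k * (L - s))).intervalIntegrable _ _)]
  ring

theorem integral_GreenK {L M x : ℝ} (hL : 0 < L) (hM : 0 < M) (hx : x ∈ Set.Icc 0 L) :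
    (∫ s in (0:ℝ)..L, GreenK M L x s) =
      x * (L - x) / (2 * M) -
        (Real.sinh (Real.sqrt M * L) - Real.sinh (Real.sqrt M * (L - x))
          - Real.sinh (Real.sqrt M * x)) / (M ^ 2 * Real.sinh (Real.sqrt M * L)) := by
  have hk : 0 < Real.sqrt M := Real.sqrt_pos.2 hM
  have hMk : M = Real.sqrt M ^ 2 := (Real.sq_sqrt hM.le).symm
  have hleft : Set.EqOn (GreenK M L x) (fun s => (L - x) / (M * L) * s -
      Real.sinh (Real.sqrt M * (L - x)) / (M * Real.sqrt M * Real.sinh (Real.sqrt M * L)) *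
        Real.sinh (Real.sqrt M * s)) (Set.uIcc 0 x) := by
    intro s hs
    rw [Set.uIcc_of_le hx.1] at hs
    simp only [GreenK]
    split_ifs with h
    · obtain rfl : x = s := le_antisymm h hs.2
      ring
    · ring
  have hright : Set.EqOn (GreenK M L x) (fun s => x / (M * L) * (L - s) -
      Real.sinh (Real.sqrt M * x) / (M * Real.sqrt M * Real.sinh (Real.sqrt M * L)) *
        Real.sinh (Real.sqrt M * (L - s))) (Set.uIcc x L) := by
    intro s hs
    rw [Set.uIcc_of_le hx.2] at hs
    simp only [GreenK, if_pos hs.1]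
    ring
  have hileft : IntervalIntegrable (GreenK M L x) MeasureTheory.volume 0 x :=
    (ContinuousOn.congr (by fun_prop) hleft).intervalIntegrable
  have hiright : IntervalIntegrable (GreenK M L x) MeasureTheory.volume x L :=
    (ContinuousOn.congr (by fun_prop) hright).intervalIntegrable
  have hlin : (∫ s in x..L, (L - s)) = (L - x) ^ 2 / 2 := by
    rw [intervalIntegral.integral_sub (by simp) (by simp), intervalIntegral.integral_const,
      integral_id, smul_eq_mul]
    ring
  rw [← intervalIntegral.integral_add_adjacent_intervals hileft hiright,
    intervalIntegral.integral_congr hleft, intervalIntegral.integral_congr hright,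
    intervalIntegral.integral_sub (Continuous.intervalIntegrable (by fun_prop) _ _)
      (Continuous.intervalIntegrable (by fun_prop) _ _),
    intervalIntegral.integral_sub (Continuous.intervalIntegrable (by fun_prop) _ _)
      (Continuous.intervalIntegrable (by fun_prop) _ _)]
  simp only [intervalIntegral.integral_const_mul]
  rw [integral_sinh_mul hk.ne', integral_sinh_mul_sub hk.ne', hlin, integral_const_mul_id]
  have hS : 0 < Real.sinh (Real.sqrt M * L) := Real.sinh_pos_iff.2 (by positivity)
  have hadd : Real.sinh (Real.sqrt M * L) =
      Real.sinh (Real.sqrt M * (L - x)) * Real.cosh (Real.sqrt M * x) +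
        Real.cosh (Real.sqrt M * (L - x)) * Real.sinh (Real.sqrt M * x) := by
    rw [← Real.sinh_add]
    ring_nf
  simp only [sub_self, mul_zero, Real.cosh_zero]
  generalize Real.sinh (Real.sqrt M * L) = S at *
  generalize Real.sinh (Real.sqrt M * (L - x)) = A at *
  generalize Real.sinh (Real.sqrt M * x) = B at *
  generalize Real.cosh (Real.sqrt M * (L - x)) = C at *
  generalize Real.cosh (Real.sqrt M * x) = D at *
  generalize Real.sqrt M = k at *
  clear hleft hright hileft hiright hlin
  subst hMk
  field_simp
  rw [hadd]
  ring

theorem stmt7 (L M : ℝ) (hL : 0 < L) (hM : 0 < M) :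
    (∫ x in (0:ℝ)..L, ∫ s in (0:ℝ)..L, GreenK M L x s)
      = ((Real.sqrt M * L) ^ 3 * Real.sinh (Real.sqrt M * L)
          + 24 * (Real.cosh (Real.sqrt M * L) - 1)
          - 12 * (Real.sqrt M * L) * Real.sinh (Real.sqrt M * L))
        / (12 * M ^ 2 * Real.sqrt M * Real.sinh (Real.sqrt M * L)) := by
  have hk : 0 < Real.sqrt M := Real.sqrt_pos.2 hM
  have hMk : M = Real.sqrt M ^ 2 := (Real.sq_sqrt hM.le).symm
  have hS : 0 < Real.sinh (Real.sqrt M * L) := Real.sinh_pos_iff.2 (by positivity)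
  have hinner : Set.EqOn (fun x => ∫ s in (0:ℝ)..L, GreenK M L x s)
      (fun x => (L / (2 * M) * x - 1 / (2 * M) * x ^ 2 - 1 / M ^ 2) +
        (1 / (M ^ 2 * Real.sinh (Real.sqrt M * L)) * Real.sinh (Real.sqrt M * (L - x)) +
          1 / (M ^ 2 * Real.sinh (Real.sqrt M * L)) * Real.sinh (Real.sqrt M * x)))
      (Set.uIcc 0 L) := by
    intro x hx
    rw [Set.uIcc_of_le hL.le] at hx
    simp only [integral_GreenK hL hM hx]
    field_simp
    ring
  rw [intervalIntegral.integral_congr hinner]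
  repeat rw [intervalIntegral.integral_add (Continuous.intervalIntegrable (by fun_prop) _ _)
    (Continuous.intervalIntegrable (by fun_prop) _ _)]
  repeat rw [intervalIntegral.integral_sub (Continuous.intervalIntegrable (by fun_prop) _ _)
    (Continuous.intervalIntegrable (by fun_prop) _ _)]
  simp only [intervalIntegral.integral_const_mul, intervalIntegral.integral_const,
    integral_sinh_mul hk.ne', integral_sinh_mul_sub hk.ne', integral_const_mul_id, integral_pow,
    smul_eq_mul, sub_self, sub_zero, mul_zero, Real.cosh_zero]
  clear hinner
  generalize Real.sinh (Real.sqrt M * L) = S at *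
  generalize Real.cosh (Real.sqrt M * L) = C at *
  generalize Real.sqrt M = k at *
  subst hMk
  push_cast
  field_simp
  ring
end

section
/- Let L > 0 and M > 0 be real numbers. For every x ∈ [0,L] one has ∫₀ᴸ G_M(x,s) ds = θ(x)/(M·sinh(√M·L)), where θ(x) = sinh(√M·L) − sinh(√M·(L−x)) − sinh(√M·x). -/
open Real

theorem GreenM_of_le {M L t s : ℝ} (h : t ≤ s) :
    GreenM M L t s = Real.sinh (Real.sqrt M * t) * Real.sinh (Real.sqrt M * (L - s)) /
      (Real.sqrt M * Real.sinh (Real.sqrt M * L)) :=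
  if_pos h

theorem GreenM_of_ge {M L t s : ℝ} (h : s ≤ t) :
    GreenM M L t s = Real.sinh (Real.sqrt M * s) * Real.sinh (Real.sqrt M * (L - t)) /
      (Real.sqrt M * Real.sinh (Real.sqrt M * L)) := by
  rcases h.eq_or_lt with rfl | h
  · exact GreenM_of_le le_rfl
  · exact if_neg h.not_ge

theorem integral_sinh_const_mul {k : ℝ} (hk : k ≠ 0) (x : ℝ) :
    ∫ s in (0:ℝ)..x, Real.sinh (k * s) = (Real.cosh (k * x) - 1) / k := by
  have hderiv (s : ℝ) : HasDerivAt (fun s => Real.cosh (k * s) / k) (Real.sinh (k * s)) s := by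
    have h := (((hasDerivAt_id s).const_mul k).cosh).div_const k
    simpa [hk] using h
  rw [intervalIntegral.integral_eq_sub_of_hasDerivAt (fun s _ => hderiv s)
    ((by fun_prop : Continuous fun s => Real.sinh (k * s)).intervalIntegrable _ _)]
  simp [sub_div]

theorem integral_sinh_const_mul_sub {k : ℝ} (hk : k ≠ 0) (x L : ℝ) :
    ∫ s in x..L, Real.sinh (k * (L - s)) = (Real.cosh (k * (L - x)) - 1) / k := by
  rw [intervalIntegral.integral_comp_sub_left (fun s => Real.sinh (k * s)) L, sub_self,
    integral_sinh_const_mul hk]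

theorem stmt8 (L M : ℝ) (hL : 0 < L) (hM : 0 < M) :
    ∀ x ∈ Set.Icc (0:ℝ) L,
      (∫ s in (0:ℝ)..L, GreenM M L x s)
        = (Real.sinh (Real.sqrt M * L) - Real.sinh (Real.sqrt M * (L - x))
            - Real.sinh (Real.sqrt M * x)) / (M * Real.sinh (Real.sqrt M * L)) := by
  intro x hx
  have hk : 0 < √M := Real.sqrt_pos.2 hM
  have hS : Real.sinh (√M * L) ≠ 0 := (Real.sinh_pos_iff.2 (mul_pos hk hL)).ne'
  have hleft : Set.EqOn (fun s => Real.sinh (√M * s) * Real.sinh (√M * (L - x)) /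
      (√M * Real.sinh (√M * L))) (GreenM M L x) (Set.uIcc 0 x) := fun s hs => by
    rw [Set.uIcc_of_le hx.1] at hs
    exact (GreenM_of_ge hs.2).symm
  have hright : Set.EqOn (fun s => Real.sinh (√M * x) * Real.sinh (√M * (L - s)) /
      (√M * Real.sinh (√M * L))) (GreenM M L x) (Set.uIcc x L) := fun s hs => by
    rw [Set.uIcc_of_le hx.2] at hs
    exact (GreenM_of_le hs.1).symm
  have hint_left : IntervalIntegrable (GreenM M L x) MeasureTheory.volume 0 x :=
    (ContinuousOn.congr (by fun_prop) hleft.symm).intervalIntegrable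
  have hint_right : IntervalIntegrable (GreenM M L x) MeasureTheory.volume x L :=
    (ContinuousOn.congr (by fun_prop) hright.symm).intervalIntegrable
  rw [← intervalIntegral.integral_add_adjacent_intervals hint_left hint_right,
    ← intervalIntegral.integral_congr hleft, ← intervalIntegral.integral_congr hright,
    intervalIntegral.integral_div, intervalIntegral.integral_div,
    intervalIntegral.integral_mul_const, intervalIntegral.integral_const_mul,
    integral_sinh_const_mul hk.ne', integral_sinh_const_mul_sub hk.ne']
  have hadd : Real.sinh (√M * L) = Real.sinh (√M * x) * Real.cosh (√M * (L - x)) +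
      Real.cosh (√M * x) * Real.sinh (√M * (L - x)) := by
    rw [← Real.sinh_add]
    ring_nf
  have hsum : (Real.cosh (√M * x) - 1) / √M * Real.sinh (√M * (L - x)) +
      Real.sinh (√M * x) * ((Real.cosh (√M * (L - x)) - 1) / √M) =
      (Real.sinh (√M * L) - Real.sinh (√M * (L - x)) - Real.sinh (√M * x)) / √M := by
    rw [hadd]
    ring
  rw [← add_div, hsum, div_div, ← mul_assoc, Real.mul_self_sqrt hM.le]
end

section
/- Let L > 0 and M > 0 be real numbers and set ξ = (√M·L/2)·sinh(√M·L) − cosh(√M·L) + 1. Then for every s ∈ [0,L] one has ξ·sinh(√M·s) ≥ (1/2)·s·(L−s)·M·sinh(√M·L) − θ(s), where θ(s) = sinh(√M·L) − sinh(√M·(L−s)) − sinh(√M·s). -/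
/-- The inequality `tanh u ≤ u` for `0 ≤ u`, in product form. -/
lemma sinh_le_mul_cosh {u : ℝ} (hu : 0 ≤ u) : Real.sinh u ≤ u * Real.cosh u := by
  have hderiv (x : ℝ) : HasDerivAt (fun x => x * Real.cosh x - Real.sinh x)
      (1 * Real.cosh x + x * Real.sinh x - Real.cosh x) x :=
    ((hasDerivAt_id x).mul (Real.hasDerivAt_cosh x)).sub (Real.hasDerivAt_sinh x)
  have hmono : MonotoneOn (fun x => x * Real.cosh x - Real.sinh x) (Set.Ici 0) := by
    refine monotoneOn_of_deriv_nonneg (convex_Ici 0)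
      (fun x _ => (hderiv x).continuousAt.continuousWithinAt)
      (fun x _ => (hderiv x).differentiableAt.differentiableWithinAt) fun x hx => ?_
    rw [interior_Ici] at hx
    rw [(hderiv x).deriv]
    have := mul_nonneg (le_of_lt hx) (Real.sinh_nonneg_iff.2 (le_of_lt hx))
    linarith
  have h := hmono Set.self_mem_Ici hu hu
  simp only [zero_mul, Real.sinh_zero, sub_zero] at h
  linarith

lemma cosh_sub_one_le_half_mul_sinh {t : ℝ} (ht : 0 ≤ t) :
    Real.cosh t - 1 ≤ t / 2 * Real.sinh t := by
  obtain ⟨u, rfl⟩ : ∃ u, t = 2 * u := ⟨t / 2, by ring⟩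
  have hu : 0 ≤ u := by linarith
  have h := mul_le_mul_of_nonneg_left (sinh_le_mul_cosh hu) (Real.sinh_nonneg_iff.2 hu)
  rw [Real.cosh_two_mul, Real.sinh_two_mul, Real.cosh_sq]
  linarith

theorem stmt9 (L M : ℝ) (hL : 0 < L) (hM : 0 < M) :
    ∀ s ∈ Set.Icc (0:ℝ) L,
      (Real.sqrt M * L / 2 * Real.sinh (Real.sqrt M * L) - Real.cosh (Real.sqrt M * L) + 1)
          * Real.sinh (Real.sqrt M * s)
        ≥ 1 / 2 * s * (L - s) * M * Real.sinh (Real.sqrt M * L)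
          - (Real.sinh (Real.sqrt M * L) - Real.sinh (Real.sqrt M * (L - s))
              - Real.sinh (Real.sqrt M * s)) := by
  rintro s ⟨hs, hsL⟩
  have hr := Real.sqrt_nonneg M
  have hquad : 1 / 2 * s * (L - s) * M
      = 1 / 2 * (√M * s) * (√M * L - √M * s) := by
    linear_combination -(1 / 2 * s * (L - s)) * Real.mul_self_sqrt hM.le
  have ht : 0 ≤ √M * s := mul_nonneg hr hs
  have hta : √M * s ≤ √M * L := mul_le_mul_of_nonneg_left hsL hr
  rw [hquad, mul_sub √M, Real.sinh_sub]
  generalize √M * s = t at *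
  generalize √M * L = a at *
  have hfactor : 0 ≤ a / 2 * (Real.sinh t - t) + 1 - Real.cosh t + t ^ 2 / 2 := by
    have h := mul_nonneg (sub_nonneg.2 hta) (sub_nonneg.2 (Real.self_le_sinh_iff.2 ht))
    linarith [cosh_sub_one_le_half_mul_sinh ht]
  have h := mul_nonneg (Real.sinh_nonneg_iff.2 (ht.trans hta)) hfactor
  linarith
end

section
/- Let σ(x) = 3x³ / (6x·cosh x + 6x − 12·sinh x − x³) for x > 0. Then the function x ↦ x²·σ(x) is decreasing on (0,∞), and x²·σ(x) ≤ 20 for all x > 0. -/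
open Real

/-- The auxiliary function `σ(x) = 3x³ / (6x cosh x + 6x − 12 sinh x − x³)`. -/
noncomputable def sigmaFun (x : ℝ) : ℝ :=
  3 * x ^ 3 / (6 * x * Real.cosh x + 6 * x - 12 * Real.sinh x - x ^ 3)

/-- Power series expansion of the denominator of `sigmaFun`. -/
lemma hasSum_sigmaFun_denom (x : ℝ) :
    HasSum (fun n : ℕ => x ^ 5 * (6 * (2 * n + 3) / (2 * n + 5).factorial * x ^ (2 * n)))
      (6 * x * cosh x + 6 * x - 12 * sinh x - x ^ 3) := by
  have h := ((Real.hasSum_cosh x).mul_left (6 * x)).sub ((Real.hasSum_sinh x).mul_left 12)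
  have h2 := (hasSum_nat_add_iff' 2).mpr h
  convert h2 using 1
  · rfl
  · funext n
    have e : ((2 * n + 5).factorial : ℝ) = (2 * n + 5) * (2 * (n + 2)).factorial := by
      rw [show 2 * (n + 2) = 2 * n + 4 by ring, Nat.factorial_succ]
      push_cast
      ring
    have hpos : ((2 * (n + 2)).factorial : ℝ) ≠ 0 := by positivity
    have hn : (2 * n + 5 : ℝ) ≠ 0 := by positivity
    rw [show 2 * (n + 2) + 1 = 2 * n + 5 by ring, e]
    field_simp
    ring
  · simp [Finset.sum_range_succ, Nat.factorial]
    ring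

/-- The denominator of `sigmaFun` divided by `x ^ 5`, as a power series. -/
lemma hasSum_sigmaFun_denom_div {x : ℝ} (hx : 0 < x) :
    HasSum (fun n : ℕ => 6 * (2 * n + 3) / ((2 * n + 5).factorial : ℝ) * x ^ (2 * n))
      ((6 * x * cosh x + 6 * x - 12 * sinh x - x ^ 3) / x ^ 5) := by
  have hx5 : x ^ 5 ≠ 0 := by positivity
  convert (hasSum_sigmaFun_denom x).div_const (x ^ 5) using 1
  · rfl
  · exact funext fun n => (mul_div_cancel_left₀ _ hx5).symm

lemma three_div_twenty_le_sigmaFun_denom_div {x : ℝ} (hx : 0 < x) :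
    3 / 20 ≤ (6 * x * cosh x + 6 * x - 12 * sinh x - x ^ 3) / x ^ 5 := by
  have h := le_hasSum (hasSum_sigmaFun_denom_div hx) 0 fun n _ => by positivity
  norm_num [Nat.factorial] at h
  exact h

lemma sq_mul_sigmaFun (x : ℝ) :
    x ^ 2 * sigmaFun x =
      3 / ((6 * x * cosh x + 6 * x - 12 * sinh x - x ^ 3) / x ^ 5) := by
  rw [sigmaFun, div_div_eq_mul_div]
  ring

theorem stmt12 :
    AntitoneOn (fun x : ℝ => x ^ 2 * sigmaFun x) (Set.Ioi 0) ∧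
    ∀ x : ℝ, 0 < x → x ^ 2 * sigmaFun x ≤ 20 := by
  constructor
  · intro x (hx : 0 < x) y (hy : 0 < y) hxy
    simp only [sq_mul_sigmaFun]
    have hpos := three_div_twenty_le_sigmaFun_denom_div hx
    refine div_le_div_of_nonneg_left (by norm_num) (by linarith) ?_
    refine hasSum_le (fun n => ?_) (hasSum_sigmaFun_denom_div hx) (hasSum_sigmaFun_denom_div hy)
    gcongr
  · intro x hx
    have h := three_div_twenty_le_sigmaFun_denom_div hx
    rw [sq_mul_sigmaFun, div_le_iff₀ (by linarith)]
    linarith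
end

section
/- For every real number x > 0 one has 6x·cosh x + 6x − 12·sinh x − x³ > 0; in particular the function σ(x) = 3x³ / (6x·cosh x + 6x − 12·sinh x − x³) is well defined and strictly positive for all x > 0. -/
open Real

/-- A function vanishing at `0` whose derivative is positive on `(0, ∞)` is positive there. -/
theorem pos_of_hasDerivAt_pos {f f' : ℝ → ℝ} (hf : ∀ x, HasDerivAt f (f' x) x) (h0 : f 0 = 0)
    (hpos : ∀ x, 0 < x → 0 < f' x) {x : ℝ} (hx : 0 < x) : 0 < f x := by
  have hmono : StrictMonoOn f (Set.Ici 0) := by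
    refine strictMonoOn_of_deriv_pos (convex_Ici 0)
      (fun y _ => (hf y).continuousAt.continuousWithinAt) fun y hy => ?_
    rw [interior_Ici] at hy
    rw [(hf y).deriv]
    exact hpos y hy
  simpa [h0] using hmono Set.self_mem_Ici hx.le hx

theorem denominator_deriv_pos {x : ℝ} (hx : 0 < x) :
    0 < 6 * x * sinh x - 6 * cosh x + 6 - 3 * x ^ 2 := by
  refine pos_of_hasDerivAt_pos (f := fun y => 6 * y * sinh y - 6 * cosh y + 6 - 3 * y ^ 2)
    (f' := fun y => 6 * y * (cosh y - 1)) (fun y => ?_) (by simp) (fun y hy => ?_) hx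
  · have h := (((((hasDerivAt_id' y).const_mul 6).mul (hasDerivAt_sinh y)).sub
      ((hasDerivAt_cosh y).const_mul 6)).add_const 6).sub ((hasDerivAt_pow 2 y).const_mul 3)
    exact h.congr_deriv (by norm_num; ring)
  · have : 0 < cosh y - 1 := sub_pos.mpr (one_lt_cosh.mpr hy.ne')
    positivity

theorem denominator_pos {x : ℝ} (hx : 0 < x) :
    0 < 6 * x * cosh x + 6 * x - 12 * sinh x - x ^ 3 := by
  refine pos_of_hasDerivAt_pos (f := fun y => 6 * y * cosh y + 6 * y - 12 * sinh y - y ^ 3)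
    (f' := fun y => 6 * y * sinh y - 6 * cosh y + 6 - 3 * y ^ 2) (fun y => ?_) (by simp)
    (fun y hy => denominator_deriv_pos hy) hx
  have h := (((((hasDerivAt_id' y).const_mul 6).mul (hasDerivAt_cosh y)).add
    ((hasDerivAt_id' y).const_mul 6)).sub ((hasDerivAt_sinh y).const_mul 12)).sub
    (hasDerivAt_pow 3 y)
  exact h.congr_deriv (by norm_num; ring)

theorem stmt13 :
    ∀ x : ℝ, 0 < x →
      0 < 6 * x * Real.cosh x + 6 * x - 12 * Real.sinh x - x ^ 3 ∧
      0 < sigmaFun x := by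
  intro x hx
  have h := denominator_pos hx
  exact ⟨h, div_pos (by positivity) h⟩
end
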